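/- arXiv:0807.5107 — 2 statements merged into one kernel-verified Lean document; each statement's English description precedes it below -/
import Mathlib

section
/- (Theorem 4.1, part 1: uniform boundedness) Under the standing hypotheses with ρ = ∞ (i.e. F'(z) ≤ k for all z ∈ ℝ) and 0 ≤ τ < 1, if sup_{t>0} g(t) < ∞ and C'(t) ≤ 0 for all t ≥ 0, then the solutions are uniformly bounded: for every δ > 0 there exists β(δ) > 0 such that for every t₀ ≥ 0 every classical solution u on [t₀,∞) with d(t₀) ≤ δ satisfies d(t) < β(δ) for all t ≥ t₀. -/
open Real Set MeasureTheory Filter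

/-- A classical solution on `[t₀, ∞)` of the initial-boundary-value problem
`-ε(t) u_xxt + u_tt - C(t) u_xx + a' u_t = F(u) - a u_t` on `(0,π) × (t₀,∞)`,
with Dirichlet boundary conditions `u(0,t) = u(π,t) = 0`.  The partial
derivatives are recorded as data, together with the hypotheses that they really
are the derivatives and that all of them are continuous on the closed
space-time domain. -/
structure ClassicalSolution (ε C F : ℝ → ℝ) (a' t₀ : ℝ) where
  u : ℝ → ℝ → ℝ
  ux : ℝ → ℝ → ℝ
  uxx : ℝ → ℝ → ℝ
  ut : ℝ → ℝ → ℝ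
  utt : ℝ → ℝ → ℝ
  uxxt : ℝ → ℝ → ℝ
  aa : ℝ → ℝ → ℝ
  hux : ∀ t ∈ Ici t₀, ∀ x ∈ Icc (0:ℝ) π,
    HasDerivWithinAt (fun y => u y t) (ux x t) (Icc 0 π) x
  huxx : ∀ t ∈ Ici t₀, ∀ x ∈ Icc (0:ℝ) π,
    HasDerivWithinAt (fun y => ux y t) (uxx x t) (Icc 0 π) x
  hut : ∀ x ∈ Icc (0:ℝ) π, ∀ t ∈ Ici t₀,
    HasDerivWithinAt (fun s => u x s) (ut x t) (Ici t₀) t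
  hutt : ∀ x ∈ Icc (0:ℝ) π, ∀ t ∈ Ici t₀,
    HasDerivWithinAt (fun s => ut x s) (utt x t) (Ici t₀) t
  huxxt : ∀ x ∈ Icc (0:ℝ) π, ∀ t ∈ Ici t₀,
    HasDerivWithinAt (fun s => uxx x s) (uxxt x t) (Ici t₀) t
  cont_u : ContinuousOn (Function.uncurry u) (Icc 0 π ×ˢ Ici t₀)
  cont_ux : ContinuousOn (Function.uncurry ux) (Icc 0 π ×ˢ Ici t₀)
  cont_uxx : ContinuousOn (Function.uncurry uxx) (Icc 0 π ×ˢ Ici t₀)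
  cont_ut : ContinuousOn (Function.uncurry ut) (Icc 0 π ×ˢ Ici t₀)
  cont_utt : ContinuousOn (Function.uncurry utt) (Icc 0 π ×ˢ Ici t₀)
  cont_uxxt : ContinuousOn (Function.uncurry uxxt) (Icc 0 π ×ˢ Ici t₀)
  cont_aa : ContinuousOn (Function.uncurry aa) (Icc 0 π ×ˢ Ici t₀)
  aa_nonneg : ∀ x ∈ Icc (0:ℝ) π, ∀ t ∈ Ici t₀, 0 ≤ aa x t
  pde : ∀ x ∈ Ioo (0:ℝ) π, ∀ t ∈ Ioi t₀,
    -(ε t) * uxxt x t + utt x t - C t * uxx x t + a' * ut x t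
      = F (u x t) - aa x t * ut x t
  bc0 : ∀ t ∈ Ici t₀, u 0 t = 0
  bcπ : ∀ t ∈ Ici t₀, u π t = 0

/-- The time-dependent norm `d(t)` of a solution:
`d(t)² = ∫₀^π [ε(t)² u_xx² + u_x² + u² + u_t²] dx`. -/
noncomputable def ClassicalSolution.d {ε C F : ℝ → ℝ} {a' t₀ : ℝ}
    (S : ClassicalSolution ε C F a' t₀) (t : ℝ) : ℝ :=
  Real.sqrt (∫ x in (0:ℝ)..π,
    ((ε t)^2 * (S.uxx x t)^2 + (S.ux x t)^2 + (S.u x t)^2 + (S.ut x t)^2))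


lemma aux_hasDerivAt_int {f f' : ℝ → ℝ → ℝ} {t₀ a b t : ℝ}
    (hf : Continuous (Function.uncurry f)) (hf' : Continuous (Function.uncurry f'))
    (h : ∀ x ∈ uIcc a b, ∀ s, t₀ < s → HasDerivAt (fun r => f x r) (f' x s) s) (ht : t₀ < t) :
    HasDerivAt (fun s => ∫ x in a..b, f x s) (∫ x in a..b, f' x t) t := by
  obtain ⟨B, hB⟩ := (isCompact_uIcc.prod (isCompact_Icc (a := t₀) (b := t + 1))).exists_bound_of_continuousOn
    (f := Function.uncurry f') (s := uIcc a b ×ˢ Icc t₀ (t+1)) hf'.continuousOn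
  have hc : ∀ s, Continuous (fun x => f x s) := fun s => hf.comp (by fun_prop : Continuous fun x => (x, s))
  have hc' : ∀ s, Continuous (fun x => f' x s) := fun s => hf'.comp (by fun_prop : Continuous fun x => (x, s))
  refine (intervalIntegral.hasDerivAt_integral_of_dominated_loc_of_deriv_le (μ := volume)
    (F := fun s x => f x s) (F' := fun s x => f' x s) (s := Ioo t₀ (t+1)) (bound := fun _ => B)
    (Ioo_mem_nhds ht (by linarith)) ?_ ?_ ?_ ?_ ?_ ?_).2
  · exact Eventually.of_forall fun s => (hc s).aestronglyMeasurable
  · exact (hc t).intervalIntegrable _ _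
  · exact (hc' t).aestronglyMeasurable
  · refine Eventually.of_forall fun x hx s hs => ?_
    exact hB (x, s) ⟨uIoc_subset_uIcc hx, hs.1.le, hs.2.le⟩
  · exact intervalIntegrable_const
  · refine Eventually.of_forall fun x hx s hs => ?_
    exact h x (uIoc_subset_uIcc hx) s hs.1

lemma aux_cont_int {f : ℝ → ℝ → ℝ} {a b : ℝ}
    (hf : Continuous (Function.uncurry f)) : Continuous (fun s => ∫ x in a..b, f x s) := by
  apply intervalIntegral.continuous_parametric_intervalIntegral_of_continuous' (f := fun s x => f x s)
  exact hf.comp continuous_swap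

lemma aux_ftc {f f' : ℝ → ℝ} {L x : ℝ} (hf : Continuous f) (hf' : Continuous f')
    (h : ∀ y ∈ Ioo 0 L, HasDerivAt f (f' y) y) (hx : x ∈ Icc 0 L) :
    ∫ y in (0:ℝ)..x, f' y = f x - f 0 :=
  intervalIntegral.integral_eq_sub_of_hasDerivAt_of_le hx.1 hf.continuousOn
    (fun y hy => h y ⟨hy.1, hy.2.trans_le hx.2⟩) (hf'.intervalIntegrable _ _)

lemma aux_slice {f : ℝ → ℝ → ℝ} (hf : Continuous (Function.uncurry f)) (t : ℝ) :
    Continuous (fun x => f x t) := hf.comp (by fun_prop : Continuous fun x : ℝ => (x, t))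

lemma aux_uxt {u ux uxx ut uxxt : ℝ → ℝ → ℝ} {t₀ : ℝ}
    (cu : Continuous (Function.uncurry u)) (cux : Continuous (Function.uncurry ux))
    (cuxx : Continuous (Function.uncurry uxx))
    (cuxxt : Continuous (Function.uncurry uxxt))
    (hux : ∀ x ∈ Ioo 0 π, ∀ t, HasDerivAt (fun y => u y t) (ux x t) x)
    (huxx : ∀ x ∈ Ioo 0 π, ∀ t, HasDerivAt (fun y => ux y t) (uxx x t) x)
    (hut : ∀ x, ∀ t, t₀ < t → HasDerivAt (fun s => u x s) (ut x t) t)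
    (huxxt : ∀ x, ∀ t, t₀ < t → HasDerivAt (fun s => uxx x s) (uxxt x t) t)
    (bc0 : ∀ t, u 0 t = 0) (bcπ : ∀ t, u π t = 0) :
    ∃ uxt : ℝ → ℝ → ℝ, Continuous (Function.uncurry uxt) ∧
      (∀ x ∈ Icc 0 π, ∀ t, t₀ < t → HasDerivAt (fun s => ux x s) (uxt x t) t) ∧
      (∀ x ∈ Ioo 0 π, ∀ t, t₀ < t → HasDerivAt (fun y => ut y t) (uxt x t) x) ∧
      (∀ x ∈ Ioo 0 π, ∀ t, t₀ < t → HasDerivAt (fun y => uxt y t) (uxxt x t) x) := by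
  have hπ := Real.pi_pos
  let q : ℝ → ℝ := fun t => -(1/π) * ∫ y in (0:ℝ)..π, (π - y) * uxxt y t
  let uxt : ℝ → ℝ → ℝ := fun x t => q t + ∫ y in (0:ℝ)..x, uxxt y t
  have cq : Continuous q := by
    refine continuous_const.mul (aux_cont_int (f := fun y t => (π - y) * uxxt y t) ?_)
    exact (by fun_prop : Continuous fun p : ℝ × ℝ => π - p.1).mul cuxxt
  have cuxt : Continuous (Function.uncurry uxt) := by
    refine (cq.comp continuous_snd).add ?_
    exact intervalIntegral.continuous_parametric_intervalIntegral_of_continuous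
      (f := fun (p : ℝ × ℝ) y => uxxt y p.2) (s := fun p => p.1)
      (cuxxt.comp (by fun_prop : Continuous fun r : (ℝ × ℝ) × ℝ => (r.2, r.1.2))) continuous_fst
  have e1 : ∀ x ∈ Icc 0 π, ∀ t, ux x t = ux 0 t + ∫ y in (0:ℝ)..x, uxx y t := by
    intro x hx t
    rw [aux_ftc (aux_slice cux t) (aux_slice cuxx t) (fun y hy => huxx y hy t) hx]; ring
  have e2 : ∀ t, ux 0 t = -(1/π) * ∫ y in (0:ℝ)..π, (π - y) * uxx y t := by
    intro t
    have h1 := aux_ftc (L := π) (x := π) (f := fun y => (π - y) * ux y t + u y t)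
      (f' := fun y => (π - y) * uxx y t)
      (((by fun_prop : Continuous fun y : ℝ => π - y).mul (aux_slice cux t)).add (aux_slice cu t))
      ((by fun_prop : Continuous fun y : ℝ => π - y).mul (aux_slice cuxx t))
      (fun y hy => by
        have := (((hasDerivAt_id y).const_sub π).mul (huxx y hy t)).add (hux y hy t)
        refine this.congr_deriv ?_
        simp) ⟨hπ.le, le_rfl⟩
    rw [h1, bc0, bcπ]; field_simp; ring
  have h1 : ∀ x ∈ Icc 0 π, ∀ t, t₀ < t → HasDerivAt (fun s => ux x s) (uxt x t) t := by
    intro x hx t ht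
    have : (fun s => ux x s) = fun s => (-(1/π) * ∫ y in (0:ℝ)..π, (π - y) * uxx y s) +
        ∫ y in (0:ℝ)..x, uxx y s := by
      funext s; rw [e1 x hx s, e2]
    rw [this]
    refine HasDerivAt.add (HasDerivAt.const_mul _ ?_) ?_
    · exact aux_hasDerivAt_int (f := fun y s => (π - y) * uxx y s) (f' := fun y s => (π - y) * uxxt y s)
        ((by fun_prop : Continuous fun p : ℝ × ℝ => π - p.1).mul cuxx)
        ((by fun_prop : Continuous fun p : ℝ × ℝ => π - p.1).mul cuxxt)
        (fun y _ s hs => (huxxt y s hs).const_mul _) ht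
    · exact aux_hasDerivAt_int cuxx cuxxt (fun y _ s hs => huxxt y s hs) ht
  have e3 : ∀ x ∈ Icc 0 π, ∀ t, t₀ < t → ut x t = ∫ y in (0:ℝ)..x, uxt y t := by
    intro x hx t ht
    have : (fun s => u x s) = fun s => ∫ y in (0:ℝ)..x, ux y s := by
      funext s
      rw [aux_ftc (aux_slice cu s) (aux_slice cux s) (fun y hy => hux y hy s) hx, bc0, sub_zero]
    refine (hut x t ht).unique ?_
    rw [this]
    refine aux_hasDerivAt_int cux cuxt (fun y hy s hs => h1 y ?_ s hs) ht
    rw [uIcc_of_le hx.1] at hy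
    exact ⟨hy.1, hy.2.trans hx.2⟩
  refine ⟨uxt, cuxt, h1, ?_, ?_⟩
  · intro x hx t ht
    have h2 : HasDerivAt (fun y => ∫ z in (0:ℝ)..y, uxt z t) (uxt x t) x :=
      (aux_slice cuxt t).integral_hasStrictDerivAt 0 x |>.hasDerivAt
    refine h2.congr_of_eventuallyEq ?_
    filter_upwards [Ioo_mem_nhds hx.1 hx.2] with y hy
    exact e3 y ⟨hy.1.le, hy.2.le⟩ t ht
  · intro x hx t ht
    exact ((aux_slice cuxxt t).integral_hasStrictDerivAt 0 x |>.hasDerivAt).const_add _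

lemma aux_sq_cot {v v' : ℝ → ℝ} (cv : Continuous v) (cv' : Continuous v')
    (h : ∀ x ∈ Ioo 0 π, HasDerivAt v (v' x) x) (h0 : v 0 = 0) :
    Tendsto (fun x => v x ^ 2 * (cos x / sin x)) (nhdsWithin 0 (Icc 0 π)) (nhds 0) := by
  have hπ := Real.pi_pos
  obtain ⟨B, hB⟩ := (isCompact_Icc (a := (0:ℝ)) (b := π)).exists_bound_of_continuousOn cv'.continuousOn
  have hB0 : 0 ≤ B := (norm_nonneg _).trans (hB 0 ⟨le_rfl, hπ.le⟩)
  have hv : ∀ x ∈ Icc 0 π, |v x| ≤ B * x := by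
    intro x hx
    have e := aux_ftc cv cv' h hx
    rw [h0, sub_zero] at e
    rw [← e]
    have := intervalIntegral.norm_integral_le_of_norm_le_const (f := v') (a := 0) (b := x) (C := B)
      (fun y hy => by
        rw [uIoc_of_le hx.1] at hy
        exact hB y ⟨hy.1.le, hy.2.trans hx.2⟩)
    simpa [abs_of_nonneg hx.1] using this
  have hlim : Tendsto (fun x : ℝ => B ^ 2 * (π / 2) * x) (nhdsWithin 0 (Icc 0 π)) (nhds 0) := by
    have : Continuous (fun x : ℝ => B ^ 2 * (π / 2) * x) := by fun_prop
    have h2 := (this.tendsto 0).mono_left (nhdsWithin_le_nhds (s := Icc 0 π))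
    simpa using h2
  refine squeeze_zero_norm' ?_ hlim
  have hm : Iio (π/2) ∈ nhdsWithin (0:ℝ) (Icc 0 π) :=
    mem_nhdsWithin_of_mem_nhds (Iio_mem_nhds (by positivity))
  filter_upwards [hm, self_mem_nhdsWithin] with x hx hx2
  rcases hx2.1.eq_or_lt with rfl | hpos
  · simp
  have hs : 2 / π * x ≤ sin x := Real.mul_le_sin hpos.le (le_of_lt hx)
  have hs0 : 0 < 2 / π * x := by positivity
  have hsin : 0 < sin x := hs0.trans_le hs
  rw [norm_mul, norm_div, Real.norm_eq_abs, Real.norm_eq_abs, Real.norm_eq_abs, abs_of_pos hsin,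
    abs_pow]
  calc |v x| ^ 2 * (|cos x| / sin x) ≤ (B * x) ^ 2 * (1 / (2 / π * x)) := by
        gcongr
        · exact hv x hx2
        · exact abs_cos_le_one x
    _ = B ^ 2 * (π / 2) * x := by field_simp

lemma aux_poincare {v v' : ℝ → ℝ} (cv : Continuous v) (cv' : Continuous v')
    (h : ∀ x ∈ Ioo 0 π, HasDerivAt v (v' x) x) (h0 : v 0 = 0) (h1 : v π = 0) :
    0 ≤ ∫ x in (0:ℝ)..π, (v' x ^ 2 - v x ^ 2) := by
  have hπ := Real.pi_pos
  let H : ℝ → ℝ := fun x => v x ^ 2 * (cos x / sin x)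
  have hc : ContinuousOn H (Icc 0 π) := by
    intro x hx
    rcases hx.1.eq_or_lt with rfl | hp
    · have := aux_sq_cot cv cv' h h0
      have e : H 0 = 0 := by simp [H]
      rw [ContinuousWithinAt, e]; exact this
    rcases hx.2.eq_or_lt with rfl | hq
    · have := aux_sq_cot (v := fun y => v (π - y)) (v' := fun y => - v' (π - y))
        (by fun_prop) (by fun_prop) (fun y hy => by
          have h2 := (h (π - y) ⟨by linarith [hy.2], by linarith [hy.1]⟩).comp y
            ((hasDerivAt_id y).const_sub π)
          refine h2.congr_deriv (by simp)) (by simpa using h1)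
      have e : H π = 0 := by simp [H]
      rw [ContinuousWithinAt, e]
      have hmap : Tendsto (fun y : ℝ => π - y) (nhdsWithin π (Icc 0 π)) (nhdsWithin 0 (Icc 0 π)) := by
        refine tendsto_nhdsWithin_iff.2 ⟨?_, ?_⟩
        · have : Continuous (fun y : ℝ => π - y) := by fun_prop
          have h2 := (this.tendsto π).mono_left (nhdsWithin_le_nhds (s := Icc 0 π))
          simpa using h2
        · filter_upwards [self_mem_nhdsWithin] with y hy
          exact ⟨by linarith [hy.2], by linarith [hy.1]⟩
      have h3 := (this.comp hmap).neg
      simp only [neg_zero] at h3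
      refine h3.congr fun y => ?_
      simp [H, Real.cos_pi_sub, Real.sin_pi_sub]
      ring
    · have hs := (Real.sin_pos_of_pos_of_lt_pi hp hq).ne'
      refine ContinuousAt.continuousWithinAt ?_
      exact (cv.continuousAt.pow 2).mul (continuous_cos.continuousAt.div continuous_sin.continuousAt hs)
  have key := intervalIntegral.sub_le_integral_of_hasDeriv_right_of_le (g := H)
    (g' := fun x => 2 * v x * v' x * (cos x / sin x) - v x ^ 2 * (1 + (cos x / sin x) ^ 2))
    (φ := fun x => v' x ^ 2 - v x ^ 2) hπ.le hc ?_ ?_ ?_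
  · simpa [H] using key
  · intro x hx
    have hs := (Real.sin_pos_of_pos_of_lt_pi hx.1 hx.2).ne'
    have := ((h x hx).pow 2).mul ((Real.hasDerivAt_cos x).div (Real.hasDerivAt_sin x) hs)
    refine (this.congr_deriv ?_).hasDerivWithinAt
    simp only [Pi.pow_apply, Pi.div_apply]
    push_cast
    field_simp
    ring
  · exact (by fun_prop : Continuous fun x => v' x ^ 2 - v x ^ 2).continuousOn.integrableOn_Icc
  · intro x hx
    nlinarith [sq_nonneg (v' x - v x * (cos x / sin x))]

lemma aux_alg (e e1 e2 c c1 f f1 a' γ θ k μ a u ux uxx ut utt uxxt uxt K1 η : ℝ)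
    (pde : -e * uxxt + utt - c * uxx + a' * ut = f - a * ut)
    (hc1 : c1 ≤ 0) (he : 0 ≤ e) (hf1 : f1 ≤ k) (hγ : 0 ≤ γ) (hθ : 0 ≤ θ) (hμ : 0 < μ)
    (hK1 : (-e2 + a' * e1) / 2 + e * k ≤ K1)
    (hη : η ≤ c - e1 / 2 - k) (hθη : θ * η = K1 + 1 / 2)
    (hd : μ * (1 + e) ≤ c - e1) (ha' : 0 ≤ a') (ha : 0 ≤ a)
    (hγa : a * (1 / (4 * μ) + θ ^ 2 / 2) ≤ γ) (hγθ : θ ≤ γ * (a' + e)) (huf : u * f ≤ k * u ^ 2) :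
    (ut - e * uxx) * (utt - e1 * uxx - e * uxxt)
      + 1 / 2 * (c1 - e2 + a' * e1 + γ * c1 + θ * e1) * ux ^ 2
      + (c - e1 + a' * e + γ * c + θ * e) * (ux * uxt) - (1 + γ) * (f * ut) + γ * (ut * utt)
      + θ * (ut * ut + u * utt + a' * (u * ut))
    ≤ (c - e1 + a' * e + γ * c) * (uxt * ux + ut * uxx) - e * (f1 * ux * ux + f * uxx)
      + γ * e * (uxt * uxt + ut * uxxt) + θ * e * (ux * uxt + u * uxxt)
      + θ * c * (ux * ux + u * uxx)
      - (θ * k + 1 / 2) * (ux ^ 2 - u ^ 2) - γ * e * (uxt ^ 2 - ut ^ 2) := by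
  have hutt : utt = e * uxxt + c * uxx - a' * ut + f - a * ut := by linarith
  subst hutt
  have T1 : 0 ≤ (1 + γ) * (-c1) / 2 * ux ^ 2 := by
    have : 0 ≤ (1 + γ) * (-c1) := mul_nonneg (by linarith) (by linarith)
    positivity
  have T2 : 0 ≤ e * (k - f1) * ux ^ 2 :=
    mul_nonneg (mul_nonneg he (by linarith)) (sq_nonneg _)
  have T2' : 0 ≤ (K1 - ((-e2 + a' * e1) / 2 + e * k)) * ux ^ 2 :=
    mul_nonneg (by linarith) (sq_nonneg _)
  have T3 : 0 ≤ (θ * (c - e1 / 2 - k) - (K1 + 1 / 2)) * ux ^ 2 := by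
    rw [← hθη, ← mul_sub]
    exact mul_nonneg (mul_nonneg hθ (by linarith)) (sq_nonneg _)
  have T4 : 0 ≤ (e * (c - e1) - μ * e ^ 2) * uxx ^ 2 := by
    refine mul_nonneg ?_ (sq_nonneg _)
    have := mul_le_mul_of_nonneg_left hd he
    nlinarith [mul_nonneg he hμ.le]
  have T5 : 0 ≤ (a' + a) * ut ^ 2 := by positivity
  have T6 : 0 ≤ μ * (e * uxx) ^ 2 - e * a * uxx * ut + 1 / (4 * μ) * (a * ut) ^ 2 := by
    have : μ * (e * uxx) ^ 2 - e * a * uxx * ut + 1 / (4 * μ) * (a * ut) ^ 2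
      = (2 * μ * (e * uxx) - a * ut) ^ 2 / (4 * μ) := by field_simp; ring
    rw [this]; positivity
  have T7 : 0 ≤ 1 / 2 * (u + θ * a * ut) ^ 2 := by positivity
  have T8 : 0 ≤ a * (γ - a * (1 / (4 * μ) + θ ^ 2 / 2)) * ut ^ 2 :=
    mul_nonneg (mul_nonneg ha (by linarith)) (sq_nonneg _)
  have T9 : 0 ≤ (γ * (a' + e) - θ) * ut ^ 2 := mul_nonneg (by linarith) (sq_nonneg _)
  have T10 : 0 ≤ θ * (k * u ^ 2 - u * f) := mul_nonneg hθ (by linarith)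
  generalize 1 / (4 * μ) = im at *
  linarith

lemma aux_alg_low (e e1 c p a' γ θ k μ u ux uxx ut η Cb : ℝ)
    (he : 0 ≤ e) (hγ : 1 ≤ γ) (hθ : 0 ≤ θ)
    (hη : 2 * η = μ + Cb - 2 * k) (hη0 : 0 < η) (hCk : k ≤ Cb) (hCb : Cb ≤ c)
    (hd : μ * (1 + e) ≤ c - e1) (hμ : 0 < μ) (ha' : 0 ≤ a')
    (hp : p ≤ k / 2 * u ^ 2) (hγθ : θ ^ 2 / (2 * η) + 1 ≤ γ / 2) :
    e ^ 2 * uxx ^ 2 + ux ^ 2 + u ^ 2 + ut ^ 2 ≤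
      (4 + 4 / η) * (1 / 2 * (ut - e * uxx) ^ 2
      + 1 / 2 * (c - e1 + a' * e + γ * c + θ * e) * ux ^ 2 - (1 + γ) * p + γ / 2 * ut ^ 2
      + θ * (u * ut + a' / 2 * u ^ 2))
      - ((4 + 4 / η) * ((1 + γ) * k / 2 + η / 2) + 1) * (ux ^ 2 - u ^ 2) := by
  have h1 : 1 / 2 * (ut - e * uxx) ^ 2 + ut ^ 2 + η / 2 * ux ^ 2 ≤
      1 / 2 * (ut - e * uxx) ^ 2
      + 1 / 2 * (c - e1 + a' * e + γ * c + θ * e) * ux ^ 2 - (1 + γ) * p + γ / 2 * ut ^ 2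
      + θ * (u * ut + a' / 2 * u ^ 2) - ((1 + γ) * k / 2 + η / 2) * (ux ^ 2 - u ^ 2) := by
    have A1 : 0 ≤ (1 + γ) * (k / 2 * u ^ 2 - p) := mul_nonneg (by linarith) (by linarith)
    have A2 : 0 ≤ θ * (a' / 2 * u ^ 2) := by positivity
    have A3 : 0 ≤ (γ / 2 - θ ^ 2 / (2 * η) - 1) * ut ^ 2 := mul_nonneg (by linarith) (sq_nonneg _)
    have A4 : 0 ≤ η / 2 * u ^ 2 + θ * (u * ut) + θ ^ 2 / (2 * η) * ut ^ 2 := by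
      have : η / 2 * u ^ 2 + θ * (u * ut) + θ ^ 2 / (2 * η) * ut ^ 2
        = (η * u + θ * ut) ^ 2 / (2 * η) := by field_simp; ring
      rw [this]; positivity
    have A5 : 0 ≤ (1 / 2 * (c - e1 + a' * e + γ * c + θ * e) - ((1 + γ) * k / 2 + η)) * ux ^ 2 := by
      refine mul_nonneg ?_ (sq_nonneg _)
      have : 0 ≤ μ * e := by positivity
      have : 0 ≤ a' * e := by positivity
      have : 0 ≤ θ * e := by positivity
      have : 0 ≤ (γ - 1) * (Cb - k) := mul_nonneg (by linarith) (by linarith)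
      have : 0 ≤ γ * (c - Cb) := mul_nonneg (by linarith) (by linarith)
      linarith
    generalize θ ^ 2 / (2 * η) = im at *
    linarith
  have hK : 0 < 4 + 4 / η := by positivity
  have h2 := mul_le_mul_of_nonneg_left h1 hK.le
  have h3 : 2 * (ut - e * uxx) ^ 2 + 4 * ut ^ 2 + 2 * ux ^ 2 ≤
      (4 + 4 / η) * (1 / 2 * (ut - e * uxx) ^ 2 + ut ^ 2 + η / 2 * ux ^ 2) := by
    have : (4 + 4 / η) * (1 / 2 * (ut - e * uxx) ^ 2 + ut ^ 2 + η / 2 * ux ^ 2)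
      = 2 * (ut - e * uxx) ^ 2 + 4 * ut ^ 2 + 2 * ux ^ 2 + (2 * η * ux ^ 2 +
        4 / η * (1 / 2 * (ut - e * uxx) ^ 2 + ut ^ 2)) := by field_simp; ring
    rw [this]
    have : 0 ≤ (2 * η * ux ^ 2 + 4 / η * (1 / 2 * (ut - e * uxx) ^ 2 + ut ^ 2)) := by positivity
    linarith
  generalize 4 + 4 / η = K at *
  linarith [sq_nonneg (2 * ut - e * uxx), sq_nonneg ut]

lemma aux_alg_up (e e1 c p a' γ θ u ux uxx ut Q N : ℝ)
    (hγ : 0 ≤ γ) (hθ : 0 ≤ θ) (ha' : 0 ≤ a') (hp : -p ≤ N)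
    (hQ1 : c ≤ Q) (hQ2 : c - e1 + a' * e + θ * e ≤ Q) (hQ : 0 ≤ Q) :
    1 / 2 * (ut - e * uxx) ^ 2
      + 1 / 2 * (c - e1 + a' * e + γ * c + θ * e) * ux ^ 2 - (1 + γ) * p + γ / 2 * ut ^ 2
      + θ * (u * ut + a' / 2 * u ^ 2) ≤
    (1 + γ) * ((2 + Q + θ + θ * a') * (e ^ 2 * uxx ^ 2 + ux ^ 2 + u ^ 2 + ut ^ 2) + N) := by
  have B1 : 0 ≤ (1 + γ) * (N + p) := mul_nonneg (by linarith) (by linarith)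
  have B2 : 0 ≤ (Q - (c - e1 + a' * e + θ * e)) * ux ^ 2 := mul_nonneg (by linarith) (sq_nonneg _)
  have B3 : 0 ≤ γ * (Q - c) * ux ^ 2 := mul_nonneg (mul_nonneg hγ (by linarith)) (sq_nonneg _)
  have B4 : 0 ≤ θ * (1 / 2 * (u - ut) ^ 2) := by positivity
  have B5 : 1 / 2 * (ut - e * uxx) ^ 2 ≤ ut ^ 2 + (e * uxx) ^ 2 := by
    linarith [sq_nonneg (ut + e * uxx)]
  have P1 : 0 ≤ θ * u ^ 2 := by positivity
  have P2 : 0 ≤ θ * ut ^ 2 := by positivity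
  have P3 : 0 ≤ θ * a' * u ^ 2 := by positivity
  have P4 : 0 ≤ Q * ux ^ 2 := by positivity
  have P5 : 0 ≤ γ * Q * ux ^ 2 := by positivity
  have P6 : 0 ≤ γ * ut ^ 2 := by positivity
  have E1 : 1 / 2 * (ut - e * uxx) ^ 2
      + 1 / 2 * (c - e1 + a' * e + γ * c + θ * e) * ux ^ 2 - (1 + γ) * p + γ / 2 * ut ^ 2
      + θ * (u * ut + a' / 2 * u ^ 2) ≤ (ut ^ 2 + (e * uxx) ^ 2) + Q * ux ^ 2 + γ * Q * ux ^ 2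
        + (1 + γ) * N + γ * ut ^ 2 + θ * u ^ 2 + θ * ut ^ 2 + θ * a' * u ^ 2 := by
    linarith
  refine E1.trans ?_
  have D : ∀ y : ℝ, 0 ≤ y → 0 ≤ (1 + γ) * y := fun y hy => mul_nonneg (by linarith) hy
  have e2 : (ut ^ 2 + (e * uxx) ^ 2) + Q * ux ^ 2 + γ * Q * ux ^ 2
        + (1 + γ) * N + γ * ut ^ 2 + θ * u ^ 2 + θ * ut ^ 2 + θ * a' * u ^ 2 ≤
      (1 + γ) * ((ut ^ 2 + (e * uxx) ^ 2) + Q * ux ^ 2 + N + θ * u ^ 2 + θ * ut ^ 2 + θ * a' * u ^ 2) := by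
    have := mul_nonneg hγ (by positivity : 0 ≤ (e * uxx) ^ 2 + θ * u ^ 2 + θ * ut ^ 2 + θ * a' * u ^ 2)
    linarith
  refine e2.trans (mul_le_mul_of_nonneg_left ?_ (by linarith))
  have : 0 ≤ (2 + Q + θ + θ * a') * (e * uxx) ^ 2 - (e * uxx) ^ 2 := by
    have : 0 ≤ (1 + Q + θ + θ * a') * (e * uxx) ^ 2 := by positivity
    linarith
  have : 0 ≤ (2 + θ + θ * a') * ux ^ 2 := by positivity
  have : 0 ≤ (2 + Q) * u ^ 2 := by positivity
  have : 0 ≤ (1 + Q + θ * a') * ut ^ 2 := by positivity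
  linarith

lemma aux_F_mul {F F' : ℝ → ℝ} {k : ℝ} (hF : ∀ z, HasDerivAt F (F' z) z) (hF0 : F 0 = 0)
    (hk : ∀ z, F' z ≤ k) (z : ℝ) : z * F z ≤ k * z ^ 2 := by
  have hm : Monotone (fun z => k * z - F z) := by
    refine monotone_of_deriv_nonneg (fun z => ?_) (fun z => ?_)
    · exact (((hasDerivAt_id z).const_mul k).sub (hF z)).differentiableAt
    · have h := ((hasDerivAt_id z).const_mul k).sub (hF z)
      have e : deriv (fun z => k * z - F z) z = k * 1 - F' z := h.deriv
      rw [e]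
      linarith [hk z]
  rcases le_total 0 z with h | h
  · have := hm h
    simp only [hF0, mul_zero, sub_zero] at this
    nlinarith
  · have := hm h
    simp only [hF0, mul_zero, sub_zero] at this
    nlinarith

lemma aux_Phi {F F' : ℝ → ℝ} {k : ℝ} (hF : ∀ z, HasDerivAt F (F' z) z) (hF0 : F 0 = 0)
    (hk : ∀ z, F' z ≤ k) (z : ℝ) : ∫ y in (0:ℝ)..z, F y ≤ k / 2 * z ^ 2 := by
  have cF : Continuous F := continuous_iff_continuousAt.2 fun z => (hF z).continuousAt
  have hi : ∀ a b : ℝ, ∫ y in a..b, k * y = k * ((b ^ 2 - a ^ 2) / 2) := by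
    intro a b; rw [intervalIntegral.integral_const_mul, integral_id]
  have hmul := aux_F_mul hF hF0 hk
  rcases le_total 0 z with h | h
  · have := intervalIntegral.integral_mono_on (μ := volume) h (cF.intervalIntegrable 0 z)
      ((by fun_prop : Continuous fun y : ℝ => k * y).intervalIntegrable 0 z) (fun y hy => by
        rcases hy.1.eq_or_lt with rfl | hp
        · simp [hF0]
        · have := hmul y
          nlinarith)
    rw [hi] at this
    linarith
  · have := intervalIntegral.integral_mono_on (μ := volume) h
      ((by fun_prop : Continuous fun y : ℝ => k * y).intervalIntegrable z 0)
      (cF.intervalIntegrable z 0) (fun y hy => by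
        rcases hy.2.eq_or_lt with rfl | hp
        · simp [hF0]
        · have := hmul y
          nlinarith)
    rw [hi] at this
    rw [intervalIntegral.integral_symm]
    linarith

/-- Globally continuous (clamped) version of a solution. -/
structure AuxSol (ε ε' ε'' C C' F F' : ℝ → ℝ) (a' t₀ : ℝ)
    (u ux uxx ut utt uxxt uxt aa : ℝ → ℝ → ℝ) : Prop where
  cε : Continuous ε
  cε' : Continuous ε'
  cε'' : Continuous ε''
  cC : Continuous C
  cC' : Continuous C'
  cF' : Continuous F'
  hε : ∀ t, t₀ < t → HasDerivAt ε (ε' t) t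
  hε' : ∀ t, t₀ < t → HasDerivAt ε' (ε'' t) t
  hC : ∀ t, t₀ < t → HasDerivAt C (C' t) t
  hF : ∀ z, HasDerivAt F (F' z) z
  hF0 : F 0 = 0
  cu : Continuous (Function.uncurry u)
  cux : Continuous (Function.uncurry ux)
  cuxx : Continuous (Function.uncurry uxx)
  cut : Continuous (Function.uncurry ut)
  cutt : Continuous (Function.uncurry utt)
  cuxxt : Continuous (Function.uncurry uxxt)
  cuxt : Continuous (Function.uncurry uxt)
  hux : ∀ x ∈ Ioo 0 π, ∀ t, HasDerivAt (fun y => u y t) (ux x t) x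
  huxx : ∀ x ∈ Ioo 0 π, ∀ t, HasDerivAt (fun y => ux y t) (uxx x t) x
  hut : ∀ x, ∀ t, t₀ < t → HasDerivAt (fun s => u x s) (ut x t) t
  hutt : ∀ x, ∀ t, t₀ < t → HasDerivAt (fun s => ut x s) (utt x t) t
  huxxt : ∀ x, ∀ t, t₀ < t → HasDerivAt (fun s => uxx x s) (uxxt x t) t
  huxt : ∀ x ∈ Icc 0 π, ∀ t, t₀ < t → HasDerivAt (fun s => ux x s) (uxt x t) t
  hutx : ∀ x ∈ Ioo 0 π, ∀ t, t₀ < t → HasDerivAt (fun y => ut y t) (uxt x t) x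
  huxtx : ∀ x ∈ Ioo 0 π, ∀ t, t₀ < t → HasDerivAt (fun y => uxt y t) (uxxt x t) x
  bc0 : ∀ t, u 0 t = 0
  bcπ : ∀ t, u π t = 0
  pde : ∀ x ∈ Ioo (0:ℝ) π, ∀ t, t₀ < t →
    -(ε t) * uxxt x t + utt x t - C t * uxx x t + a' * ut x t
      = F (u x t) - aa x t * ut x t
  aa_nonneg : ∀ x ∈ Icc (0:ℝ) π, ∀ t, t₀ < t → 0 ≤ aa x t

/-- Liapunov density. -/
noncomputable def auxw (ε ε' C F : ℝ → ℝ) (a' γ θ : ℝ) (u ux uxx ut : ℝ → ℝ → ℝ) (x t : ℝ) : ℝ :=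
  1 / 2 * (ut x t - ε t * uxx x t) ^ 2
      + 1 / 2 * (C t - ε' t + a' * ε t + γ * C t + θ * ε t) * ux x t ^ 2
      - (1 + γ) * (∫ y in (0:ℝ)..(u x t), F y) + γ / 2 * ut x t ^ 2
      + θ * (u x t * ut x t + a' / 2 * u x t ^ 2)

section
variable {ε ε' ε'' C C' F F' : ℝ → ℝ} {a' t₀ : ℝ} {u ux uxx ut utt uxxt uxt aa : ℝ → ℝ → ℝ}

lemma AuxSol.cF (S : AuxSol ε ε' ε'' C C' F F' a' t₀ u ux uxx ut utt uxxt uxt aa) : Continuous F :=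
  continuous_iff_continuousAt.2 fun z => (S.hF z).continuousAt

lemma AuxSol.cw (S : AuxSol ε ε' ε'' C C' F F' a' t₀ u ux uxx ut utt uxxt uxt aa) (γ θ : ℝ) :
    Continuous (Function.uncurry (auxw ε ε' C F a' γ θ u ux uxx ut)) := by
  have cPhi : Continuous (fun z => ∫ y in (0:ℝ)..z, F y) :=
    intervalIntegral.continuous_primitive (fun a b => S.cF.intervalIntegrable a b) 0
  have cPhiu := cPhi.comp S.cu
  have cu := S.cu
  have cux := S.cux
  have cuxx := S.cuxx
  have cut := S.cut
  have cε := S.cε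
  have cε' := S.cε'
  have cC := S.cC
  simp only [Function.uncurry_def, Function.comp_def] at *
  unfold auxw
  fun_prop

lemma AuxSol.poincare_u (S : AuxSol ε ε' ε'' C C' F F' a' t₀ u ux uxx ut utt uxxt uxt aa) (t : ℝ) :
    0 ≤ ∫ x in (0:ℝ)..π, (ux x t ^ 2 - u x t ^ 2) :=
  aux_poincare (aux_slice S.cu t) (aux_slice S.cux t) (fun x hx => S.hux x hx t) (S.bc0 t) (S.bcπ t)

lemma AuxSol.ut0 (S : AuxSol ε ε' ε'' C C' F F' a' t₀ u ux uxx ut utt uxxt uxt aa) {t : ℝ}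
    (ht : t₀ < t) : ut 0 t = 0 := by
  refine (S.hut 0 t ht).unique ?_
  simp only [S.bc0]
  exact hasDerivAt_const t (0:ℝ)

lemma AuxSol.utπ (S : AuxSol ε ε' ε'' C C' F F' a' t₀ u ux uxx ut utt uxxt uxt aa) {t : ℝ}
    (ht : t₀ < t) : ut π t = 0 := by
  refine (S.hut π t ht).unique ?_
  simp only [S.bcπ]
  exact hasDerivAt_const t (0:ℝ)

lemma AuxSol.poincare_ut (S : AuxSol ε ε' ε'' C C' F F' a' t₀ u ux uxx ut utt uxxt uxt aa) {t : ℝ}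
    (ht : t₀ < t) :
    0 ≤ ∫ x in (0:ℝ)..π, (uxt x t ^ 2 - ut x t ^ 2) :=
  aux_poincare (aux_slice S.cut t) (aux_slice S.cuxt t) (fun x hx => S.hutx x hx t ht)
    (S.ut0 ht) (S.utπ ht)

lemma AuxSol.deriv_w (S : AuxSol ε ε' ε'' C C' F F' a' t₀ u ux uxx ut utt uxxt uxt aa) (γ θ : ℝ)
    {t : ℝ} (ht : t₀ < t) :
    HasDerivAt (fun s => ∫ x in (0:ℝ)..π, auxw ε ε' C F a' γ θ u ux uxx ut x s)
      (∫ x in (0:ℝ)..π, ((ut x t - ε t * uxx x t) * (utt x t - ε' t * uxx x t - ε t * uxxt x t)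
      + 1 / 2 * (C' t - ε'' t + a' * ε' t + γ * C' t + θ * ε' t) * ux x t ^ 2
      + (C t - ε' t + a' * ε t + γ * C t + θ * ε t) * (ux x t * uxt x t)
      - (1 + γ) * (F (u x t) * ut x t) + γ * (ut x t * utt x t)
      + θ * (ut x t * ut x t + u x t * utt x t + a' * (u x t * ut x t)))) t := by
  refine aux_hasDerivAt_int (t₀ := t₀) (f' := fun x t =>
    ((ut x t - ε t * uxx x t) * (utt x t - ε' t * uxx x t - ε t * uxxt x t)
      + 1 / 2 * (C' t - ε'' t + a' * ε' t + γ * C' t + θ * ε' t) * ux x t ^ 2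
      + (C t - ε' t + a' * ε t + γ * C t + θ * ε t) * (ux x t * uxt x t)
      - (1 + γ) * (F (u x t) * ut x t) + γ * (ut x t * utt x t)
      + θ * (ut x t * ut x t + u x t * utt x t + a' * (u x t * ut x t)))) (S.cw γ θ) ?_ ?_ ht
  · have cu := S.cu
    have cux := S.cux
    have cuxx := S.cuxx
    have cut := S.cut
    have cutt := S.cutt
    have cuxxt := S.cuxxt
    have cuxt := S.cuxt
    have cε := S.cε
    have cε' := S.cε'
    have cε'' := S.cε''
    have cC := S.cC
    have cC' := S.cC'
    have cF := S.cF
    simp only [Function.uncurry_def] at *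
    fun_prop
  · intro x hx s hs
    rw [uIcc_of_le Real.pi_pos.le] at hx
    have dP : HasDerivAt (fun r => ∫ y in (0:ℝ)..(u x r), F y) (F (u x s) * ut x s) s := by
      have := (S.cF.integral_hasStrictDerivAt 0 (u x s)).hasDerivAt
      exact this.comp s (S.hut x s hs)
    have dA := ((((S.hutt x s hs).sub ((S.hε s hs).mul (S.huxxt x s hs))).pow 2).const_mul (1/2))
    have dc := ((((S.hC s hs).sub (S.hε' s hs)).add ((S.hε s hs).const_mul a')).add
      ((S.hC s hs).const_mul γ)).add ((S.hε s hs).const_mul θ)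
    have dB := (dc.const_mul (1/2)).mul ((S.huxt x hx s hs).pow 2)
    have dD := dP.const_mul (1 + γ)
    have dE := ((S.hutt x s hs).pow 2).const_mul (γ/2)
    have dG := (((S.hut x s hs).mul (S.hutt x s hs)).add
      (((S.hut x s hs).pow 2).const_mul (a'/2))).const_mul θ
    have := ((((dA.add dB).sub dD).add dE).add dG)
    refine HasDerivAt.congr_deriv (f := fun r => auxw ε ε' C F a' γ θ u ux uxx ut x r) this ?_
    simp
    ring

lemma AuxSol.decay (S : AuxSol ε ε' ε'' C C' F F' a' t₀ u ux uxx ut utt uxxt uxt aa)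
    {γ θ k μ K1 η am t₁ : ℝ} (ht : t₀ ≤ t₁)
    (hC' : ∀ t, C' t ≤ 0) (hε : ∀ t, 0 ≤ ε t) (hFk : ∀ z, F' z ≤ k) (hk : 0 ≤ k)
    (hγ : 0 ≤ γ) (hθ : 0 ≤ θ)
    (hμ : 0 < μ) (hK1 : ∀ t, (-ε'' t + a' * ε' t) / 2 + ε t * k ≤ K1)
    (hη : ∀ t, η ≤ C t - ε' t / 2 - k) (hθη : θ * η = K1 + 1 / 2)
    (hd : ∀ t, μ * (1 + ε t) ≤ C t - ε' t) (ha' : 0 ≤ a')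
    (ham : ∀ x ∈ Icc 0 π, ∀ t ∈ Ioo t₀ t₁, aa x t ≤ am)
    (hγa : am * (1 / (4 * μ) + θ ^ 2 / 2) ≤ γ) (hγθ : ∀ t, θ ≤ γ * (a' + ε t)) :
    ∫ x in (0:ℝ)..π, auxw ε ε' C F a' γ θ u ux uxx ut x t₁ ≤
      ∫ x in (0:ℝ)..π, auxw ε ε' C F a' γ θ u ux uxx ut x t₀ := by
  have hπ := Real.pi_pos
  have hanti : AntitoneOn (fun s => ∫ x in (0:ℝ)..π, auxw ε ε' C F a' γ θ u ux uxx ut x s)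
      (Icc t₀ t₁) := by
    refine antitoneOn_of_deriv_nonpos (convex_Icc _ _) (aux_cont_int (S.cw γ θ)).continuousOn ?_ ?_
    · intro t htt
      rw [interior_Icc] at htt
      exact (S.deriv_w γ θ htt.1).differentiableAt.differentiableWithinAt
    intro t htt
    rw [interior_Icc] at htt
    rw [(S.deriv_w γ θ htt.1).deriv]
    have ht0 := htt.1
    have cu := aux_slice S.cu t
    have cux := aux_slice S.cux t
    have cuxx := aux_slice S.cuxx t
    have cut := aux_slice S.cut t
    have cutt := aux_slice S.cutt t
    have cuxxt := aux_slice S.cuxxt t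
    have cuxt := aux_slice S.cuxt t
    have cF := S.cF
    have cF' := S.cF'
    have cJ : Continuous fun x => (C t - ε' t + a' * ε t + γ * C t) * (uxt x t * ux x t + ut x t * uxx x t)
      - ε t * (F' (u x t) * ux x t * ux x t + F (u x t) * uxx x t)
      + γ * ε t * (uxt x t * uxt x t + ut x t * uxxt x t)
      + θ * ε t * (ux x t * uxt x t + u x t * uxxt x t)
      + θ * C t * (ux x t * ux x t + u x t * uxx x t) := by fun_prop
    have cp1 : Continuous fun x => (θ * k + 1 / 2) * (ux x t ^ 2 - u x t ^ 2) := by fun_prop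
    have cp2 : Continuous fun x => γ * ε t * (uxt x t ^ 2 - ut x t ^ 2) := by fun_prop
    have hJ : ∫ x in (0:ℝ)..π, ((C t - ε' t + a' * ε t + γ * C t) * (uxt x t * ux x t + ut x t * uxx x t)
      - ε t * (F' (u x t) * ux x t * ux x t + F (u x t) * uxx x t)
      + γ * ε t * (uxt x t * uxt x t + ut x t * uxxt x t)
      + θ * ε t * (ux x t * uxt x t + u x t * uxxt x t)
      + θ * C t * (ux x t * ux x t + u x t * uxx x t)) = 0 := by
      have := aux_ftc (L := π) (x := π) (f := fun x =>
          (C t - ε' t + a' * ε t + γ * C t) * (ut x t * ux x t)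
          - ε t * (F (u x t) * ux x t) + γ * ε t * (ut x t * uxt x t)
          + θ * ε t * (u x t * uxt x t) + θ * C t * (u x t * ux x t)) (by fun_prop) cJ
          (fun x hx => by
            have d1 := (S.hutx x hx t ht0).mul (S.huxx x hx t)
            have d2 := ((S.hF (u x t)).comp x (S.hux x hx t)).mul (S.huxx x hx t)
            have d3 := (S.hutx x hx t ht0).mul (S.huxtx x hx t ht0)
            have d4 := (S.hux x hx t).mul (S.huxtx x hx t ht0)
            have d5 := (S.hux x hx t).mul (S.huxx x hx t)
            exact ((((d1.const_mul _).sub (d2.const_mul _)).add (d3.const_mul _)).add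
              (d4.const_mul _)).add (d5.const_mul _)) ⟨hπ.le, le_rfl⟩
      rw [this, S.ut0 ht0, S.utπ ht0, S.bc0, S.bcπ, S.hF0]
      ring
    have hmono := intervalIntegral.integral_mono_on_of_le_Ioo (μ := volume) (a := 0) (b := π)
      (f := fun x => (ut x t - ε t * uxx x t) * (utt x t - ε' t * uxx x t - ε t * uxxt x t)
      + 1 / 2 * (C' t - ε'' t + a' * ε' t + γ * C' t + θ * ε' t) * ux x t ^ 2
      + (C t - ε' t + a' * ε t + γ * C t + θ * ε t) * (ux x t * uxt x t)
      - (1 + γ) * (F (u x t) * ut x t) + γ * (ut x t * utt x t)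
      + θ * (ut x t * ut x t + u x t * utt x t + a' * (u x t * ut x t))) hπ.le
      (Continuous.intervalIntegrable (by fun_prop) _ _)
      (((cJ.sub cp1).sub cp2).intervalIntegrable _ _)
      (fun x hx => by
        have hxI : x ∈ Icc 0 π := ⟨hx.1.le, hx.2.le⟩
        have ha0 := S.aa_nonneg x hxI t ht0
        refine aux_alg (ε t) (ε' t) (ε'' t) (C t) (C' t) (F (u x t)) (F' (u x t)) a' γ θ k μ (aa x t)
          (u x t) (ux x t) (uxx x t) (ut x t) (utt x t) (uxxt x t) (uxt x t) K1 η
          (S.pde x hx t ht0) (hC' t) (hε t) (hFk _) hγ hθ hμ (hK1 t) (hη t) hθη (hd t) ha' ha0 ?_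
          (hγθ t) (aux_F_mul S.hF S.hF0 hFk _)
        refine le_trans (mul_le_mul_of_nonneg_right (ham x hxI t htt) (by positivity)) hγa)
    refine hmono.trans ?_
    simp only [Pi.sub_apply]
    have c12 := cJ.sub cp1
    simp only [Pi.sub_def] at c12
    rw [intervalIntegral.integral_sub (c12.intervalIntegrable _ _) (cp2.intervalIntegrable _ _),
      intervalIntegral.integral_sub (cJ.intervalIntegrable _ _) (cp1.intervalIntegrable _ _), hJ,
      intervalIntegral.integral_const_mul, intervalIntegral.integral_const_mul]
    have p1 := mul_nonneg (by positivity : 0 ≤ θ * k + 1 / 2) (S.poincare_u t)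
    have p2 := mul_nonneg (mul_nonneg hγ (hε t)) (S.poincare_ut ht0)
    linarith
  exact hanti ⟨le_rfl, ht⟩ ⟨ht, le_rfl⟩ ht

lemma AuxSol.lower (S : AuxSol ε ε' ε'' C C' F F' a' t₀ u ux uxx ut utt uxxt uxt aa)
    {γ θ k μ η Cb : ℝ} (t : ℝ)
    (he : ∀ t, 0 ≤ ε t) (hγ : 1 ≤ γ) (hθ : 0 ≤ θ) (hk : 0 ≤ k)
    (hη : 2 * η = μ + Cb - 2 * k) (hη0 : 0 < η) (hCk : k ≤ Cb) (hCb : ∀ t, Cb ≤ C t)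
    (hd : ∀ t, μ * (1 + ε t) ≤ C t - ε' t) (hμ : 0 < μ) (ha' : 0 ≤ a') (hFk : ∀ z, F' z ≤ k)
    (hγθ : θ ^ 2 / (2 * η) + 1 ≤ γ / 2) :
    ∫ x in (0:ℝ)..π, (ε t ^ 2 * uxx x t ^ 2 + ux x t ^ 2 + u x t ^ 2 + ut x t ^ 2) ≤
      (4 + 4 / η) * ∫ x in (0:ℝ)..π, auxw ε ε' C F a' γ θ u ux uxx ut x t := by
  have hπ := Real.pi_pos
  have cu := aux_slice S.cu t
  have cux := aux_slice S.cux t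
  have cuxx := aux_slice S.cuxx t
  have cut := aux_slice S.cut t
  have cw := aux_slice (S.cw γ θ) t
  have c1 : Continuous fun x => (4 + 4 / η) * auxw ε ε' C F a' γ θ u ux uxx ut x t := by fun_prop
  have c2 : Continuous fun x => ((4 + 4 / η) * ((1 + γ) * k / 2 + η / 2) + 1) *
    (ux x t ^ 2 - u x t ^ 2) := by fun_prop
  have hmono := intervalIntegral.integral_mono_on (μ := volume) (a := 0) (b := π)
    (f := fun x => ε t ^ 2 * uxx x t ^ 2 + ux x t ^ 2 + u x t ^ 2 + ut x t ^ 2) hπ.le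
    (Continuous.intervalIntegrable (by fun_prop) _ _)
    ((c1.sub c2).intervalIntegrable _ _)
    (fun x hx => aux_alg_low (ε t) (ε' t) (C t) _ a' γ θ k μ (u x t) (ux x t) (uxx x t) (ut x t) η Cb
      (he t) hγ hθ hη hη0 hCk (hCb t) (hd t) hμ ha' (aux_Phi S.hF S.hF0 hFk (u x t)) hγθ)
  refine hmono.trans ?_
  simp only [Pi.sub_apply]
  rw [intervalIntegral.integral_sub (c1.intervalIntegrable _ _) (c2.intervalIntegrable _ _),
    intervalIntegral.integral_const_mul, intervalIntegral.integral_const_mul]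
  have := mul_nonneg (by positivity : 0 ≤ (4 + 4 / η) * ((1 + γ) * k / 2 + η / 2) + 1) (S.poincare_u t)
  linarith

lemma AuxSol.upper (S : AuxSol ε ε' ε'' C C' F F' a' t₀ u ux uxx ut utt uxxt uxt aa)
    {γ θ Q N δ : ℝ} (t : ℝ)
    (hγ : 0 ≤ γ) (hθ : 0 ≤ θ) (ha' : 0 ≤ a')
    (hN : ∀ z ∈ Icc (-((π + δ ^ 2) / 2)) ((π + δ ^ 2) / 2), -(∫ y in (0:ℝ)..z, F y) ≤ N)
    (hQ1 : ∀ t, C t ≤ Q) (hQ2 : ∀ t, C t - ε' t + a' * ε t + θ * ε t ≤ Q) (hQ : 0 ≤ Q)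
    (hδ : ∫ x in (0:ℝ)..π, (ε t ^ 2 * uxx x t ^ 2 + ux x t ^ 2 + u x t ^ 2 + ut x t ^ 2) ≤ δ ^ 2) :
    ∫ x in (0:ℝ)..π, auxw ε ε' C F a' γ θ u ux uxx ut x t ≤
      (1 + γ) * ((2 + Q + θ + θ * a') * δ ^ 2 + π * N) := by
  have hπ := Real.pi_pos
  have cu := aux_slice S.cu t
  have cux := aux_slice S.cux t
  have cuxx := aux_slice S.cuxx t
  have cut := aux_slice S.cut t
  have cw := aux_slice (S.cw γ θ) t
  have cden : Continuous fun x => ε t ^ 2 * uxx x t ^ 2 + ux x t ^ 2 + u x t ^ 2 + ut x t ^ 2 := by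
    fun_prop
  have hu : ∀ x ∈ Icc 0 π, |u x t| ≤ (π + δ ^ 2) / 2 := by
    intro x hx
    have e := aux_ftc cu cux (fun y hy => S.hux y hy t) hx
    rw [S.bc0, sub_zero] at e
    rw [← e]
    have cg : Continuous fun y => 1 / 2 * (1 + (ε t ^ 2 * uxx y t ^ 2 + ux y t ^ 2 + u y t ^ 2 + ut y t ^ 2)) := by
      fun_prop
    calc |∫ y in (0:ℝ)..x, ux y t| ≤ ∫ y in (0:ℝ)..x, |ux y t| :=
          intervalIntegral.abs_integral_le_integral_abs hx.1
      _ ≤ ∫ y in (0:ℝ)..x, 1 / 2 * (1 + (ε t ^ 2 * uxx y t ^ 2 + ux y t ^ 2 + u y t ^ 2 + ut y t ^ 2)) := by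
          refine intervalIntegral.integral_mono_on hx.1 (cux.abs.intervalIntegrable _ _)
            (cg.intervalIntegrable _ _) fun y _ => ?_
          have h1 : 0 ≤ ε t ^ 2 * uxx y t ^ 2 + u y t ^ 2 + ut y t ^ 2 := by positivity
          have h2 := sq_nonneg (|ux y t| - 1)
          have h3 := sq_abs (ux y t)
          nlinarith
      _ ≤ ∫ y in (0:ℝ)..π, 1 / 2 * (1 + (ε t ^ 2 * uxx y t ^ 2 + ux y t ^ 2 + u y t ^ 2 + ut y t ^ 2)) := by
          refine intervalIntegral.integral_mono_interval le_rfl hx.1 hx.2 ?_ (cg.intervalIntegrable _ _)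
          refine Eventually.of_forall fun y => ?_
          simp only [Pi.zero_apply]
          positivity
      _ ≤ (π + δ ^ 2) / 2 := by
          rw [intervalIntegral.integral_const_mul, intervalIntegral.integral_add
            intervalIntegrable_const (cden.intervalIntegrable _ _)]
          simp only [intervalIntegral.integral_const, smul_eq_mul]
          linarith
  have hmono := intervalIntegral.integral_mono_on (μ := volume) (a := 0) (b := π)
    (g := fun x => (1 + γ) * ((2 + Q + θ + θ * a') *
      (ε t ^ 2 * uxx x t ^ 2 + ux x t ^ 2 + u x t ^ 2 + ut x t ^ 2) + N)) hπ.le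
    (cw.intervalIntegrable _ _) (Continuous.intervalIntegrable (by fun_prop) _ _)
    (fun x hx => aux_alg_up (ε t) (ε' t) (C t) _ a' γ θ (u x t) (ux x t) (uxx x t) (ut x t) Q N
      hγ hθ ha' (hN (u x t) (abs_le.1 (hu x hx))) (hQ1 t) (hQ2 t) hQ)
  refine hmono.trans ?_
  rw [intervalIntegral.integral_const_mul, intervalIntegral.integral_add
    (Continuous.intervalIntegrable (by fun_prop) _ _) intervalIntegrable_const,
    intervalIntegral.integral_const_mul]
  simp only [intervalIntegral.integral_const, smul_eq_mul, sub_zero]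
  have h1 := mul_le_mul_of_nonneg_left hδ (by positivity : 0 ≤ 2 + Q + θ + θ * a')
  exact mul_le_mul_of_nonneg_left (by linarith) (by linarith)

end

lemma aux_ext {f : ℝ → ℝ} {b : ℝ} (hf : ContinuousOn f (Ici 0)) (h : ∀ t ∈ Ioi (0:ℝ), b ≤ f t) :
    ∀ t ∈ Ici (0:ℝ), b ≤ f t := by
  intro t ht
  have hx : t ∈ closure (Ioi (0:ℝ)) := by rw [closure_Ioi]; exact ht
  exact ContinuousWithinAt.closure_le hx continuousWithinAt_const
    ((hf t ht).mono Ioi_subset_Ici_self) h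

lemma aux_clamp1_cont {f : ℝ → ℝ} (hf : ContinuousOn f (Ici 0)) :
    Continuous (fun t => f (max 0 t)) :=
  hf.comp_continuous (by fun_prop) (fun t => le_max_left 0 t)

lemma aux_clamp1_deriv {f f' : ℝ → ℝ}
    (hf : ∀ t ∈ Ici (0:ℝ), HasDerivWithinAt f (f' t) (Ici 0) t) {t : ℝ} (ht : 0 < t) :
    HasDerivAt (fun s => f (max 0 s)) (f' (max 0 t)) t := by
  have h1 := (hf t ht.le).hasDerivAt (Ici_mem_nhds ht)
  rw [max_eq_right ht.le]
  refine h1.congr_of_eventuallyEq ?_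
  filter_upwards [Ioi_mem_nhds ht] with s hs
  rw [max_eq_right (le_of_lt hs)]

/-- Clamping of a function on the strip. -/
noncomputable def auxClamp (t₀ : ℝ) (v : ℝ → ℝ → ℝ) (x t : ℝ) : ℝ := v (max 0 (min π x)) (max t₀ t)

lemma aux_proj_mem (x : ℝ) : max 0 (min π x) ∈ Icc 0 π :=
  ⟨le_max_left _ _, max_le Real.pi_pos.le (min_le_left _ _)⟩

lemma aux_proj_eq {x : ℝ} (hx : x ∈ Icc 0 π) : max 0 (min π x) = x := by
  rw [min_eq_right hx.2, max_eq_right hx.1]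

lemma auxClamp_eq {t₀ : ℝ} {v : ℝ → ℝ → ℝ} {x t : ℝ} (hx : x ∈ Icc 0 π) (ht : t₀ ≤ t) :
    auxClamp t₀ v x t = v x t := by
  unfold auxClamp
  rw [aux_proj_eq hx, max_eq_right ht]

lemma auxClamp_cont {t₀ : ℝ} {v : ℝ → ℝ → ℝ}
    (hv : ContinuousOn (Function.uncurry v) (Icc 0 π ×ˢ Ici t₀)) :
    Continuous (Function.uncurry (auxClamp t₀ v)) := by
  have := hv.comp_continuous (f := fun p : ℝ × ℝ => (max 0 (min π p.1), max t₀ p.2)) (by fun_prop)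
    (fun p => ⟨aux_proj_mem _, mem_Ici.2 (le_max_left _ _)⟩)
  exact this

lemma auxClamp_dt {t₀ : ℝ} {v v' : ℝ → ℝ → ℝ}
    (h : ∀ x ∈ Icc (0:ℝ) π, ∀ t ∈ Ici t₀, HasDerivWithinAt (fun s => v x s) (v' x t) (Ici t₀) t)
    (x t : ℝ) (ht : t₀ < t) :
    HasDerivAt (fun s => auxClamp t₀ v x s) (auxClamp t₀ v' x t) t := by
  have h1 := (h _ (aux_proj_mem x) t ht.le).hasDerivAt (Ici_mem_nhds ht)
  unfold auxClamp
  rw [max_eq_right ht.le]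
  refine h1.congr_of_eventuallyEq ?_
  filter_upwards [Ioi_mem_nhds ht] with s hs
  rw [max_eq_right (le_of_lt (mem_Ioi.1 hs) : t₀ ≤ s)]

lemma auxClamp_dx {t₀ : ℝ} {v v' : ℝ → ℝ → ℝ}
    (h : ∀ t ∈ Ici t₀, ∀ x ∈ Icc (0:ℝ) π, HasDerivWithinAt (fun y => v y t) (v' x t) (Icc 0 π) x)
    (x : ℝ) (hx : x ∈ Ioo 0 π) (t : ℝ) :
    HasDerivAt (fun y => auxClamp t₀ v y t) (auxClamp t₀ v' x t) x := by
  have h1 := (h (max t₀ t) (mem_Ici.2 (le_max_left _ _)) x ⟨hx.1.le, hx.2.le⟩).hasDerivAt (Icc_mem_nhds hx.1 hx.2)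
  unfold auxClamp
  rw [aux_proj_eq ⟨hx.1.le, hx.2.le⟩]
  refine h1.congr_of_eventuallyEq ?_
  filter_upwards [Ioo_mem_nhds hx.1 hx.2] with y hy
  rw [aux_proj_eq ⟨hy.1.le, hy.2.le⟩]

set_option maxHeartbeats 1600000

/-- Theorem 4.1, part 1 (uniform boundedness): with `ρ = ∞`, `0 ≤ τ < 1`,
`sup_(t>0) g(t) < ∞` and `C' ≤ 0`, the solutions are uniformly bounded. -/
theorem solutions_uniformly_bounded
    (ε ε' ε'' C C' F F' : ℝ → ℝ) (a' A τ k μ Cbar εbar ebar : ℝ)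
    (hεderiv : ∀ t ∈ Ici (0:ℝ), HasDerivWithinAt ε (ε' t) (Ici 0) t)
    (hε'deriv : ∀ t ∈ Ici (0:ℝ), HasDerivWithinAt ε' (ε'' t) (Ici 0) t)
    (hε''cont : ContinuousOn ε'' (Ici 0))
    (hεnonneg : ∀ t ∈ Ici (0:ℝ), 0 ≤ ε t)
    (hCderiv : ∀ t ∈ Ici (0:ℝ), HasDerivWithinAt C (C' t) (Ici 0) t)
    (hC'cont : ContinuousOn C' (Ici 0))
    (hFderiv : ∀ z, HasDerivAt F (F' z) z)
    (hF'cont : Continuous F')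
    (hF0 : F 0 = 0)
    (hCbar : IsGLB (C '' Ioi (0:ℝ)) Cbar) (hCbarpos : 0 < Cbar)
    (hεbar : IsGLB (ε '' Ioi (0:ℝ)) εbar)
    (hebar : IsGLB (ε'' '' Ioi (0:ℝ)) ebar)
    (hA : 0 ≤ A) (hτ : 0 ≤ τ) (hk : 0 ≤ k) (hμ : 0 < μ)
    (hFk : ∀ z, F' z ≤ k)
    (hCk : k ≤ Cbar)
    (hdiss : ∀ t ∈ Ici (0:ℝ), μ * (1 + ε t) ≤ C t - ε' t)
    (hmuk : 0 < μ + Cbar / 2 - 2 * k)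
    (ha' : 0 ≤ a')
    (ha'ε : 0 < a' + εbar / 2)
    (hτ1 : τ < 1)
    (hg : ∃ gM, ∀ t ∈ Ioi (0:ℝ), C t - ε' t / 2 + 1 ≤ gM)
    (hC' : ∀ t ∈ Ici (0:ℝ), C' t ≤ 0)
    :
    ∀ δ, 0 < δ →
      ∃ β, 0 < β ∧
        ∀ t₀, (0:ℝ) ≤ t₀ →
          ∀ S : ClassicalSolution ε C F a' t₀,
            (∀ x ∈ Icc (0:ℝ) π, ∀ t ∈ Ici t₀, S.aa x t ≤ A * S.d t ^ τ) →
            S.d t₀ ≤ δ → ∀ t, t₀ ≤ t → S.d t < β := by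
  intro δ hδ
  obtain ⟨gM, hgM⟩ := hg
  have hπ := Real.pi_pos
  have cε : ContinuousOn ε (Ici 0) := fun t ht => (hεderiv t ht).continuousWithinAt
  have cε' : ContinuousOn ε' (Ici 0) := fun t ht => (hε'deriv t ht).continuousWithinAt
  have cC : ContinuousOn C (Ici 0) := fun t ht => (hCderiv t ht).continuousWithinAt
  have bC : ∀ t ∈ Ici (0:ℝ), Cbar ≤ C t :=
    aux_ext cC fun t ht => hCbar.1 (mem_image_of_mem _ ht)
  have bε : ∀ t ∈ Ici (0:ℝ), εbar ≤ ε t :=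
    aux_ext cε fun t ht => hεbar.1 (mem_image_of_mem _ ht)
  have be : ∀ t ∈ Ici (0:ℝ), ebar ≤ ε'' t :=
    aux_ext hε''cont fun t ht => hebar.1 (mem_image_of_mem _ ht)
  have hεb0 : 0 ≤ εbar := by
    refine hεbar.2 ?_
    rintro _ ⟨t, ht, rfl⟩
    exact hεnonneg t (Ioi_subset_Ici_self ht)
  have bg : ∀ t ∈ Ici (0:ℝ), -gM ≤ -(C t - ε' t / 2 + 1) := by
    refine aux_ext (by fun_prop) fun t ht => ?_
    linarith [hgM t ht]
  have bC0 : ∀ t ∈ Ici (0:ℝ), C t ≤ C 0 := by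
    have : AntitoneOn C (Ici 0) := by
      refine antitoneOn_of_deriv_nonpos (convex_Ici 0) cC ?_ ?_
      · intro t ht
        rw [interior_Ici] at ht
        exact ((hCderiv t (Ioi_subset_Ici_self ht)).hasDerivAt (Ici_mem_nhds ht)).differentiableAt.differentiableWithinAt
      · intro t ht
        rw [interior_Ici] at ht
        rw [((hCderiv t (Ioi_subset_Ici_self ht)).hasDerivAt (Ici_mem_nhds ht)).deriv]
        exact hC' t (Ioi_subset_Ici_self ht)
    intro t ht
    exact this (le_refl (0:ℝ)) ht ht
  obtain ⟨C0, hC0⟩ : ∃ c, c = C 0 := ⟨_, rfl⟩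
  rw [← hC0] at bC0
  have hC0pos : 0 < C0 := by
    have := bC 0 (le_refl (0:ℝ))
    rw [← hC0] at this; linarith
  obtain ⟨G, hG⟩ : ∃ G, G = |gM| := ⟨_, rfl⟩
  have hG0 : 0 ≤ G := hG ▸ abs_nonneg _
  have hGg : gM ≤ G := hG ▸ le_abs_self _
  have bε'l : ∀ t ∈ Ici (0:ℝ), -(2 * G) ≤ ε' t := fun t ht => by
    linarith [bg t ht, bC t ht]
  have bε'u : ∀ t ∈ Ici (0:ℝ), ε' t ≤ C0 := fun t ht => by
    have := mul_nonneg hμ.le (by linarith [hεnonneg t ht] : 0 ≤ 1 + ε t)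
    linarith [hdiss t ht, bC0 t ht]
  obtain ⟨Em, hEm⟩ : ∃ E, E = (C0 + 2 * G) / μ := ⟨_, rfl⟩
  have hEm0 : 0 ≤ Em := by rw [hEm]; positivity
  have bεu : ∀ t ∈ Ici (0:ℝ), ε t ≤ Em := fun t ht => by
    rw [hEm, le_div_iff₀ hμ]
    linarith [hdiss t ht, bC0 t ht, bε'l t ht]
  obtain ⟨K1, hK1⟩ : ∃ K, K = (|ebar| + a' * C0) / 2 + Em * k := ⟨_, rfl⟩
  have hK10 : 0 ≤ K1 := by rw [hK1]; positivity
  obtain ⟨η, hη⟩ : ∃ η, η = (μ + Cbar - 2 * k) / 2 := ⟨_, rfl⟩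
  have hη0 : 0 < η := by linarith
  obtain ⟨θ, hθ⟩ : ∃ θ, θ = (K1 + 1 / 2) / η := ⟨_, rfl⟩
  have hθ0 : 0 ≤ θ := by rw [hθ]; positivity
  have hθη : θ * η = K1 + 1 / 2 := by rw [hθ]; field_simp
  obtain ⟨ν, hν⟩ : ∃ ν, ν = a' + εbar := ⟨_, rfl⟩
  have hν0 : 0 < ν := by linarith
  obtain ⟨Q, hQ⟩ : ∃ Q, Q = C0 + (C0 + 2 * G) + (a' + θ) * Em := ⟨_, rfl⟩
  have hQ0 : 0 ≤ Q := by rw [hQ]; positivity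
  have cF : Continuous F := continuous_iff_continuousAt.2 fun z => (hFderiv z).continuousAt
  have cPhi : Continuous (fun z => ∫ y in (0:ℝ)..z, F y) :=
    intervalIntegral.continuous_primitive (fun a b => cF.intervalIntegrable a b) 0
  obtain ⟨N, hN⟩ := (isCompact_Icc (a := -((π + δ ^ 2) / 2))
    (b := (π + δ ^ 2) / 2)).exists_bound_of_continuousOn cPhi.continuousOn
  have hN0 : 0 ≤ N := by
    have hr : 0 ≤ (π + δ ^ 2) / 2 := by positivity
    exact (norm_nonneg _).trans (hN 0 ⟨by linarith, hr⟩)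
  obtain ⟨m, hm⟩ : ∃ m, m = (2 + Q + θ + θ * a') * δ ^ 2 + π * N := ⟨_, rfl⟩
  have hm0 : 0 ≤ m := by rw [hm]; positivity
  obtain ⟨Kc, hKc⟩ : ∃ K, K = 4 + 4 / η := ⟨_, rfl⟩
  have hKc0 : 0 ≤ Kc := by rw [hKc]; positivity
  obtain ⟨γ0, hγ0⟩ : ∃ g, g = 1 + θ / ν + 2 * (θ ^ 2 / (2 * η) + 1) := ⟨_, rfl⟩
  have hr1 : 0 ≤ θ / ν := by positivity
  have hr2 : 0 ≤ θ ^ 2 / (2 * η) := by positivity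
  have hγ00 : 0 ≤ γ0 := by linarith
  obtain ⟨M, hM⟩ : ∃ M, M = A * (1 / (4 * μ) + θ ^ 2 / 2) := ⟨_, rfl⟩
  have hM0 : 0 ≤ M := by rw [hM]; positivity
  obtain ⟨σ, hσ⟩ : ∃ s, s = 1 + δ + Kc * m * (1 + γ0 + M) := ⟨_, rfl⟩
  have hr3 : 0 ≤ Kc * m * (1 + γ0 + M) := by positivity
  have hσ1 : 1 ≤ σ := by linarith
  have hσδ : δ < σ := by linarith
  obtain ⟨γ, hγ⟩ : ∃ g, g = γ0 + M * σ := ⟨_, rfl⟩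
  have hMσ : 0 ≤ M * σ := by positivity
  have hfin : Kc * ((1 + γ) * m) < σ ^ 2 := by
    have h1 : Kc * m * (1 + γ0 + M) < σ := by linarith
    have h2 : Kc * m * (1 + γ0 + M * σ) ≤ Kc * m * ((1 + γ0 + M) * σ) := by
      refine mul_le_mul_of_nonneg_left ?_ (by positivity)
      have h3 : 1 + γ0 ≤ (1 + γ0) * σ := le_mul_of_one_le_right (by linarith) hσ1
      linarith
    have h4 : Kc * m * (1 + γ0 + M) * σ < σ * σ := mul_lt_mul_of_pos_right h1 (by linarith)
    rw [hγ]
    calc Kc * ((1 + (γ0 + M * σ)) * m) = Kc * m * (1 + γ0 + M * σ) := by ring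
      _ ≤ Kc * m * ((1 + γ0 + M) * σ) := h2
      _ = Kc * m * (1 + γ0 + M) * σ := by ring
      _ < σ * σ := h4
      _ = σ ^ 2 := by ring
  refine ⟨σ, by linarith, ?_⟩
  intro t₀ ht₀ S hSa hSd t ht
  -- clamped solution
  obtain ⟨uxt, cuxt, huxt, hutx, huxtx⟩ := aux_uxt (t₀ := t₀) (auxClamp_cont S.cont_u)
    (auxClamp_cont S.cont_ux) (auxClamp_cont S.cont_uxx) (auxClamp_cont S.cont_uxxt)
    (auxClamp_dx S.hux) (auxClamp_dx S.huxx) (auxClamp_dt S.hut) (auxClamp_dt S.huxxt)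
    (fun t => by
      unfold auxClamp
      rw [aux_proj_eq ⟨le_rfl, hπ.le⟩]; exact S.bc0 _ (mem_Ici.2 (le_max_left _ _)))
    (fun t => by
      unfold auxClamp
      rw [aux_proj_eq ⟨hπ.le, le_rfl⟩]; exact S.bcπ _ (mem_Ici.2 (le_max_left _ _)))
  have T : AuxSol (fun t => ε (max 0 t)) (fun t => ε' (max 0 t)) (fun t => ε'' (max 0 t))
      (fun t => C (max 0 t)) (fun t => C' (max 0 t)) F F' a' t₀
      (auxClamp t₀ S.u) (auxClamp t₀ S.ux) (auxClamp t₀ S.uxx) (auxClamp t₀ S.ut)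
      (auxClamp t₀ S.utt) (auxClamp t₀ S.uxxt) uxt (auxClamp t₀ S.aa) :=
    { cε := aux_clamp1_cont cε
      cε' := aux_clamp1_cont cε'
      cε'' := aux_clamp1_cont hε''cont
      cC := aux_clamp1_cont cC
      cC' := aux_clamp1_cont hC'cont
      cF' := hF'cont
      hε := fun t ht => aux_clamp1_deriv hεderiv (ht₀.trans_lt ht)
      hε' := fun t ht => aux_clamp1_deriv hε'deriv (ht₀.trans_lt ht)
      hC := fun t ht => aux_clamp1_deriv hCderiv (ht₀.trans_lt ht)
      hF := hFderiv
      hF0 := hF0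
      cu := auxClamp_cont S.cont_u
      cux := auxClamp_cont S.cont_ux
      cuxx := auxClamp_cont S.cont_uxx
      cut := auxClamp_cont S.cont_ut
      cutt := auxClamp_cont S.cont_utt
      cuxxt := auxClamp_cont S.cont_uxxt
      cuxt := cuxt
      hux := auxClamp_dx S.hux
      huxx := auxClamp_dx S.huxx
      hut := auxClamp_dt S.hut
      hutt := auxClamp_dt S.hutt
      huxxt := auxClamp_dt S.huxxt
      huxt := huxt
      hutx := hutx
      huxtx := huxtx
      bc0 := fun t => by
        unfold auxClamp
        rw [aux_proj_eq ⟨le_rfl, hπ.le⟩]; exact S.bc0 _ (mem_Ici.2 (le_max_left _ _))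
      bcπ := fun t => by
        unfold auxClamp
        rw [aux_proj_eq ⟨hπ.le, le_rfl⟩]; exact S.bcπ _ (mem_Ici.2 (le_max_left _ _))
      pde := fun x hx t ht => by
        have hx' : x ∈ Icc 0 π := ⟨hx.1.le, hx.2.le⟩
        simp only [auxClamp_eq hx' ht.le, max_eq_right (ht₀.trans ht.le)]
        exact S.pde x hx t ht
      aa_nonneg := fun x hx t ht => by
        rw [auxClamp_eq hx ht.le]
        exact S.aa_nonneg x hx t ht.le }
  have hpos : ∀ t : ℝ, max 0 t ∈ Ici (0:ℝ) := fun t => le_max_left 0 t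
  let D : ℝ → ℝ := fun t => ∫ x in (0:ℝ)..π, (ε (max 0 t) ^ 2 * auxClamp t₀ S.uxx x t ^ 2 +
    auxClamp t₀ S.ux x t ^ 2 + auxClamp t₀ S.u x t ^ 2 + auxClamp t₀ S.ut x t ^ 2)
  have cD : Continuous D := by
    refine aux_cont_int (f := fun x t => (ε (max 0 t) ^ 2 * auxClamp t₀ S.uxx x t ^ 2 +
      auxClamp t₀ S.ux x t ^ 2 + auxClamp t₀ S.u x t ^ 2 + auxClamp t₀ S.ut x t ^ 2)) ?_
    exact (((((T.cε.comp continuous_snd).pow 2).mul (T.cuxx.pow 2)).add (T.cux.pow 2)).add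
      (T.cu.pow 2)).add (T.cut.pow 2)
  have hDd : ∀ s, t₀ ≤ s → S.d s = Real.sqrt (D s) := by
    intro s hs
    unfold ClassicalSolution.d
    congr 1
    refine intervalIntegral.integral_congr fun x hx => ?_
    rw [uIcc_of_le hπ.le] at hx
    simp only [auxClamp_eq hx hs, max_eq_right (ht₀.trans hs)]
  have hσ0 : 0 < σ := by linarith
  by_contra hcon
  have hDt : σ ^ 2 ≤ D t := by
    rw [hDd t ht, not_lt] at hcon
    exact (Real.le_sqrt' hσ0).1 hcon
  obtain ⟨t₁, ht₁, hmin⟩ := ((isCompact_Icc (a := t₀) (b := t)).inter_right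
    (isClosed_le (continuous_const (y := σ ^ 2)) cD)).exists_isLeast ⟨t, ⟨ht, le_rfl⟩, hDt⟩
  have hlt : ∀ s, t₀ ≤ s → s < t₁ → S.d s < σ := by
    intro s hs hs1
    rw [hDd s hs, Real.sqrt_lt' hσ0]
    by_contra hh
    exact absurd (hmin ⟨⟨hs, hs1.le.trans ht₁.1.2⟩, not_lt.1 hh⟩) (not_le.2 hs1)
  have hdec := T.decay (γ := γ) (θ := θ) (k := k) (μ := μ) (K1 := K1) (η := η) (am := A * σ) ht₁.1.1
    (fun t => hC' _ (hpos t)) (fun t => hεnonneg _ (hpos t)) hFk hk (by linarith) hθ0 hμ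
    (fun t => by
      have h1 := be _ (hpos t)
      have h2 := mul_le_mul_of_nonneg_left (bε'u _ (hpos t)) ha'
      have h3 := mul_le_mul_of_nonneg_right (bεu _ (hpos t)) hk
      have h4 := neg_abs_le ebar
      linarith)
    (fun t => by
      have h1 := hdiss _ (hpos t)
      have h2 := bC _ (hpos t)
      have h3 := mul_nonneg hμ.le (hεnonneg _ (hpos t))
      linarith) hθη (fun t => hdiss _ (hpos t)) ha'
    (fun x hx s hs => by
      rw [auxClamp_eq hx hs.1.le]
      refine (hSa x hx s hs.1.le).trans (mul_le_mul_of_nonneg_left ?_ hA)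
      calc S.d s ^ τ ≤ σ ^ τ := Real.rpow_le_rpow (Real.sqrt_nonneg _) (hlt s hs.1.le hs.2).le hτ
        _ ≤ σ ^ (1:ℝ) := Real.rpow_le_rpow_of_exponent_le hσ1 hτ1.le
        _ = σ := Real.rpow_one σ)
    (by
      have : A * σ * (1 / (4 * μ) + θ ^ 2 / 2) = M * σ := by rw [hM]; ring
      rw [this]; linarith)
    (fun t => by
      have h1 := bε _ (hpos t)
      have h2 : θ / ν * ν = θ := by field_simp
      have h3 : θ / ν ≤ γ := by linarith
      calc θ = θ / ν * ν := h2.symm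
        _ ≤ γ * (a' + ε (max 0 t)) := by
            refine mul_le_mul h3 (by linarith) hν0.le (by linarith))
  have hlow := T.lower (γ := γ) (θ := θ) (k := k) (μ := μ) (η := η) (Cb := Cbar) t₁
    (fun t => hεnonneg _ (hpos t)) (by linarith) hθ0 hk (by linarith) hη0 hCk (fun t => bC _ (hpos t))
    (fun t => hdiss _ (hpos t)) hμ ha' hFk (by linarith)
  have hup := T.upper (γ := γ) (θ := θ) (Q := Q) (N := N) (δ := δ) t₀ (by linarith) hθ0 ha'
    (fun z hz => (neg_le_abs _).trans (hN z hz))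
    (fun t => by
      have h1 := bC0 _ (hpos t)
      have : 0 ≤ (a' + θ) * Em := by positivity
      linarith)
    (fun t => by
      have h1 := bC0 _ (hpos t)
      have h2 := bε'l _ (hpos t)
      have h3 := mul_le_mul_of_nonneg_left (bεu _ (hpos t)) (by linarith : 0 ≤ a' + θ)
      linarith) hQ0
    (by
      have h1 := hSd
      rw [hDd t₀ le_rfl] at h1
      exact (Real.sqrt_le_left hδ.le).1 h1)
  rw [← hm] at hup
  rw [← hKc] at hlow
  have h1 : σ ^ 2 ≤ D t₁ := ht₁.2
  have h2 := mul_le_mul_of_nonneg_left (hdec.trans hup) hKc0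
  exact absurd (h1.trans (hlow.trans h2)) (not_le.2 hfin)
end

section
/- (Theorem 4.1, part 2: exponential-asymptotic stability in the large) Under the standing hypotheses with ρ = ∞ (i.e. F'(z) ≤ k for all z ∈ ℝ) and 0 ≤ τ < 1, if sup_{t>0} g(t) < ∞ and C'(t) ≤ 0 for all t ≥ 0, then the null solution is exponential-asymptotically stable in the large: for every δ > 0 there exist positive constants D(δ), E(δ) such that for every t₀ ≥ 0 every classical solution u on [t₀,∞) with d(t₀) ≤ δ satisfies d(t) ≤ D(δ)·exp(−E(δ)(t − t₀))·d(t₀) for all t ≥ t₀. -/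
open Real Set MeasureTheory Filter

theorem aux_ftc_s5 {h h' : ℝ → ℝ}
    (hd : ∀ x ∈ Icc (0:ℝ) π, HasDerivWithinAt h (h' x) (Icc 0 π) x)
    (hc : ContinuousOn h' (Icc 0 π)) : ∫ x in (0:ℝ)..π, h' x = h π - h 0 := by
  apply intervalIntegral.integral_eq_sub_of_hasDerivAt_of_le pi_pos.le
  · exact fun x hx => (hd x hx).continuousWithinAt
  · exact fun x hx => (hd x (Ioo_subset_Icc_self hx)).hasDerivAt (Icc_mem_nhds hx.1 hx.2)
  · exact ContinuousOn.intervalIntegrable (by rwa [uIcc_of_le pi_pos.le])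

theorem aux_ii {h : ℝ → ℝ} (hc : ContinuousOn h (Icc 0 π)) :
    IntervalIntegrable h volume 0 π :=
  ContinuousOn.intervalIntegrable (by rwa [uIcc_of_le pi_pos.le])

theorem aux_green {f f1 f2 : ℝ → ℝ}
    (h1 : ∀ x ∈ Icc (0:ℝ) π, HasDerivWithinAt f (f1 x) (Icc 0 π) x)
    (h2 : ∀ x ∈ Icc (0:ℝ) π, HasDerivWithinAt f1 (f2 x) (Icc 0 π) x)
    (c2 : ContinuousOn f2 (Icc 0 π)) (f0 : f 0 = 0) (fp : f π = 0) :
    ∫ x in (0:ℝ)..π, f1 x ^ 2 = - ∫ x in (0:ℝ)..π, f x * f2 x := by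
  have c0 : ContinuousOn f (Icc 0 π) := fun x hx => (h1 x hx).continuousWithinAt
  have c1 : ContinuousOn f1 (Icc 0 π) := fun x hx => (h2 x hx).continuousWithinAt
  have := aux_ftc_s5 (h := fun x => f x * f1 x) (h' := fun x => f1 x * f1 x + f x * f2 x)
    (fun x hx => (h1 x hx).mul (h2 x hx)) (by fun_prop)
  rw [intervalIntegral.integral_add (aux_ii (by fun_prop)) (aux_ii (by fun_prop)), f0, fp] at this
  simp only [pow_two]
  linarith

theorem aux_wirt {f f1 : ℝ → ℝ}
    (h1 : ∀ x ∈ Icc (0:ℝ) π, HasDerivWithinAt f (f1 x) (Icc 0 π) x)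
    (c1 : ContinuousOn f1 (Icc 0 π)) (f0 : f 0 = 0) (fp : f π = 0) :
    ∫ x in (0:ℝ)..π, f x ^ 2 ≤ ∫ x in (0:ℝ)..π, f1 x ^ 2 := by
  have c0 : ContinuousOn f (Icc 0 π) := fun x hx => (h1 x hx).continuousWithinAt
  have key : ∀ l ∈ Ioo (0:ℝ) 1, l ^ 2 * ∫ x in (0:ℝ)..π, f x ^ 2 ≤ ∫ x in (0:ℝ)..π, f1 x ^ 2 := by
    intro l hl
    have hcos : ∀ x ∈ Icc (0:ℝ) π, Real.cos (l * (x - π / 2)) ≠ 0 := by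
      intro x hx
      apply ne_of_gt
      apply Real.cos_pos_of_mem_Ioo
      have hp := pi_pos
      constructor <;> nlinarith [hx.1, hx.2, hl.1, hl.2]
    set φ : ℝ → ℝ := fun x => - l * Real.tan (l * (x - π / 2)) with hφ
    have hφd : ∀ x ∈ Icc (0:ℝ) π,
        HasDerivWithinAt φ (- l ^ 2 - φ x ^ 2) (Icc 0 π) x := by
      intro x hx
      have hin : HasDerivAt (fun x : ℝ => l * (x - π / 2)) (l * 1) x :=
        ((hasDerivAt_id x).sub_const _).const_mul l
      have h := ((Real.hasDerivAt_tan (hcos x hx)).comp x hin).const_mul (-l)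
      refine (h.congr_deriv ?_).hasDerivWithinAt
      have hc := hcos x hx
      simp only [hφ, Real.tan_eq_sin_div_cos]
      have := Real.sin_sq_add_cos_sq (l * (x - π / 2))
      generalize l * (x - π / 2) = w at *
      field_simp
      linear_combination (l ^ 2) * this
    have cφ : ContinuousOn φ (Icc 0 π) := fun x hx => (hφd x hx).continuousWithinAt
    have e := aux_ftc_s5 (h := fun x => f x ^ 2 * φ x)
      (h' := fun x => (2 * f x * f1 x) * φ x + f x ^ 2 * (- l ^ 2 - φ x ^ 2))
      (fun x hx => by
        exact (((h1 x hx).pow 2).mul (hφd x hx)).congr_deriv (by simp)) (by fun_prop)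
    rw [f0, fp] at e
    have e2 : ∫ x in (0:ℝ)..π, ((f1 x ^ 2 - l ^ 2 * f x ^ 2)
        - ((2 * f x * f1 x) * φ x + f x ^ 2 * (- l ^ 2 - φ x ^ 2))) =
        ∫ x in (0:ℝ)..π, (f1 x - f x * φ x) ^ 2 := by
      congr 1; ext x; ring
    have e3 : 0 ≤ ∫ x in (0:ℝ)..π, (f1 x - f x * φ x) ^ 2 :=
      intervalIntegral.integral_nonneg pi_pos.le (fun x _ => sq_nonneg _)
    rw [intervalIntegral.integral_sub (aux_ii (by fun_prop)) (aux_ii (by fun_prop)),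
      intervalIntegral.integral_sub (aux_ii (by fun_prop)) (aux_ii (by fun_prop)),
      intervalIntegral.integral_const_mul] at e2
    linarith
  have ht : Tendsto (fun l : ℝ => l ^ 2 * ∫ x in (0:ℝ)..π, f x ^ 2) (nhdsWithin 1 (Iio 1))
      (nhds (1 ^ 2 * ∫ x in (0:ℝ)..π, f x ^ 2)) := by
    apply Tendsto.mono_left _ nhdsWithin_le_nhds
    exact ((continuous_id.pow 2).mul continuous_const).tendsto 1
  have := le_of_tendsto ht (by
    filter_upwards [Ioo_mem_nhdsLT (show (0:ℝ) < 1 by norm_num)] with l hl using key l hl)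
  linarith

/-- slopes are bounded near `t` and integrals of slopes behave well -/
theorem aux_slope {f ft : ℝ → ℝ → ℝ} {t₀ t : ℝ} (ht : t₀ ≤ t)
    (hd : ∀ x ∈ Icc (0:ℝ) π, ∀ t ∈ Ici t₀, HasDerivWithinAt (fun s => f x s) (ft x t) (Ici t₀) t)
    (hc : ContinuousOn (Function.uncurry ft) (Icc 0 π ×ˢ Ici t₀)) :
    ∃ M, ∀ᶠ s in nhdsWithin t (Ici t₀ \ {t}), ∀ x ∈ Icc (0:ℝ) π, |slope (f x) t s| ≤ M := by
  have hK : IsCompact (Icc (0:ℝ) π ×ˢ Icc t₀ (t+1)) := isCompact_Icc.prod isCompact_Icc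
  obtain ⟨M, hM⟩ := hK.exists_bound_of_continuousOn
    (hc.mono (prod_mono subset_rfl Icc_subset_Ici_self))
  refine ⟨M, ?_⟩
  have h1 : ∀ᶠ s in nhdsWithin t (Ici t₀ \ {t}), s < t + 1 :=
    nhdsWithin_le_nhds (Iio_mem_nhds (by linarith))
  filter_upwards [h1, self_mem_nhdsWithin] with s hs hs' x hx
  have hb := (convex_Icc t₀ (t+1)).norm_image_sub_le_of_norm_hasDerivWithin_le
    (f := fun s => f x s) (f' := fun s => ft x s) (C := M) (x := t) (y := s)
    (fun r hr => (hd x hx r hr.1).mono Icc_subset_Ici_self)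
    (fun r hr => hM (x, r) ⟨hx, hr⟩) ⟨ht, by linarith⟩ ⟨hs'.1, hs.le⟩
  have hne : s - t ≠ 0 := sub_ne_zero.mpr hs'.2
  rw [slope_def_field, abs_div, div_le_iff₀ (abs_pos.mpr hne)]
  exact hb

theorem aux_diff {f ft : ℝ → ℝ → ℝ} {t₀ t : ℝ} (ht : t₀ ≤ t)
    (hd : ∀ x ∈ Icc (0:ℝ) π, ∀ t ∈ Ici t₀, HasDerivWithinAt (fun s => f x s) (ft x t) (Ici t₀) t)
    (hc0 : ContinuousOn (Function.uncurry f) (Icc 0 π ×ˢ Ici t₀))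
    (hc : ContinuousOn (Function.uncurry ft) (Icc 0 π ×ˢ Ici t₀)) :
    HasDerivWithinAt (fun s => ∫ x in (0:ℝ)..π, f x s) (∫ x in (0:ℝ)..π, ft x t) (Ici t₀) t := by
  have hcs : ∀ s ∈ Ici t₀, ContinuousOn (fun x => f x s) (Icc 0 π) := fun s hs =>
    hc0.comp (f := fun x => (x, s)) (by fun_prop) (fun x hx => ⟨hx, hs⟩)
  rw [hasDerivWithinAt_iff_tendsto_slope]
  obtain ⟨M, hM⟩ := aux_slope ht hd hc
  have hlim : Tendsto (fun s => ∫ x in (0:ℝ)..π, slope (f x) t s) (nhdsWithin t (Ici t₀ \ {t}))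
      (nhds (∫ x in (0:ℝ)..π, ft x t)) := by
    apply intervalIntegral.tendsto_integral_filter_of_dominated_convergence (fun _ => M)
    · filter_upwards [self_mem_nhdsWithin] with s hs
      have : ContinuousOn (fun x => slope (f x) t s) (Icc 0 π) := by
        simp only [slope_def_field]
        exact ((hcs s hs.1).sub (hcs t ht)).div_const _
      rw [uIoc_of_le pi_pos.le]
      exact (this.mono Ioc_subset_Icc_self).aestronglyMeasurable measurableSet_Ioc
    · filter_upwards [hM] with s hs
      refine Eventually.of_forall fun x hx => ?_
      rw [uIoc_of_le pi_pos.le] at hx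
      exact hs x (Ioc_subset_Icc_self hx)
    · exact intervalIntegrable_const
    · refine Eventually.of_forall fun x hx => ?_
      rw [uIoc_of_le pi_pos.le] at hx
      exact hasDerivWithinAt_iff_tendsto_slope.mp (hd x (Ioc_subset_Icc_self hx) t ht)
  refine hlim.congr' ?_
  filter_upwards [self_mem_nhdsWithin] with s hs
  simp only [slope_def_field]
  rw [intervalIntegral.integral_div, intervalIntegral.integral_sub (aux_ii (hcs s hs.1))
    (aux_ii (hcs t ht))]

/-- Integral of product of slopes. -/
theorem aux_slope_mul {f ft g gt : ℝ → ℝ → ℝ} {t₀ t : ℝ} (ht : t₀ ≤ t)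
    (hd : ∀ x ∈ Icc (0:ℝ) π, ∀ t ∈ Ici t₀, HasDerivWithinAt (fun s => f x s) (ft x t) (Ici t₀) t)
    (hc0 : ContinuousOn (Function.uncurry f) (Icc 0 π ×ˢ Ici t₀))
    (hc : ContinuousOn (Function.uncurry ft) (Icc 0 π ×ˢ Ici t₀))
    (gd : ∀ x ∈ Icc (0:ℝ) π, ∀ t ∈ Ici t₀, HasDerivWithinAt (fun s => g x s) (gt x t) (Ici t₀) t)
    (gc0 : ContinuousOn (Function.uncurry g) (Icc 0 π ×ˢ Ici t₀))
    (gc : ContinuousOn (Function.uncurry gt) (Icc 0 π ×ˢ Ici t₀)) :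
    Tendsto (fun s => ∫ x in (0:ℝ)..π, slope (f x) t s * slope (g x) t s)
      (nhdsWithin t (Ici t₀ \ {t})) (nhds (∫ x in (0:ℝ)..π, ft x t * gt x t)) := by
  have hcs : ∀ s ∈ Ici t₀, ContinuousOn (fun x => f x s) (Icc 0 π) := fun s hs =>
    hc0.comp (f := fun x => (x, s)) (by fun_prop) (fun x hx => ⟨hx, hs⟩)
  have gcs : ∀ s ∈ Ici t₀, ContinuousOn (fun x => g x s) (Icc 0 π) := fun s hs =>
    gc0.comp (f := fun x => (x, s)) (by fun_prop) (fun x hx => ⟨hx, hs⟩)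
  obtain ⟨M, hM⟩ := aux_slope ht hd hc
  obtain ⟨N, hN⟩ := aux_slope ht gd gc
  apply intervalIntegral.tendsto_integral_filter_of_dominated_convergence (fun _ => M * N)
  · filter_upwards [self_mem_nhdsWithin] with s hs
    have : ContinuousOn (fun x => slope (f x) t s * slope (g x) t s) (Icc 0 π) := by
      simp only [slope_def_field]
      exact (((hcs s hs.1).sub (hcs t ht)).div_const _).mul
        (((gcs s hs.1).sub (gcs t ht)).div_const _)
    rw [uIoc_of_le pi_pos.le]
    exact (this.mono Ioc_subset_Icc_self).aestronglyMeasurable measurableSet_Ioc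
  · filter_upwards [hM, hN] with s hs hs'
    refine Eventually.of_forall fun x hx => ?_
    rw [uIoc_of_le pi_pos.le] at hx
    have h1 := hs x (Ioc_subset_Icc_self hx)
    have h2 := hs' x (Ioc_subset_Icc_self hx)
    rw [Real.norm_eq_abs, abs_mul]
    exact mul_le_mul h1 h2 (abs_nonneg _) ((abs_nonneg _).trans h1)
  · exact intervalIntegrable_const
  · refine Eventually.of_forall fun x hx => ?_
    rw [uIoc_of_le pi_pos.le] at hx
    exact (hasDerivWithinAt_iff_tendsto_slope.mp (hd x (Ioc_subset_Icc_self hx) t ht)).mul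
      (hasDerivWithinAt_iff_tendsto_slope.mp (gd x (Ioc_subset_Icc_self hx) t ht))

theorem aux_green_sym {f f1 f2 g g1 g2 : ℝ → ℝ}
    (h1 : ∀ x ∈ Icc (0:ℝ) π, HasDerivWithinAt f (f1 x) (Icc 0 π) x)
    (h2 : ∀ x ∈ Icc (0:ℝ) π, HasDerivWithinAt f1 (f2 x) (Icc 0 π) x)
    (c2 : ContinuousOn f2 (Icc 0 π)) (f0 : f 0 = 0) (fp : f π = 0)
    (k1 : ∀ x ∈ Icc (0:ℝ) π, HasDerivWithinAt g (g1 x) (Icc 0 π) x)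
    (k2 : ∀ x ∈ Icc (0:ℝ) π, HasDerivWithinAt g1 (g2 x) (Icc 0 π) x)
    (d2 : ContinuousOn g2 (Icc 0 π)) (g0 : g 0 = 0) (gp : g π = 0) :
    ∫ x in (0:ℝ)..π, f x * g2 x = ∫ x in (0:ℝ)..π, f2 x * g x := by
  have c0 : ContinuousOn f (Icc 0 π) := fun x hx => (h1 x hx).continuousWithinAt
  have c1 : ContinuousOn f1 (Icc 0 π) := fun x hx => (h2 x hx).continuousWithinAt
  have d0 : ContinuousOn g (Icc 0 π) := fun x hx => (k1 x hx).continuousWithinAt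
  have d1 : ContinuousOn g1 (Icc 0 π) := fun x hx => (k2 x hx).continuousWithinAt
  have := aux_ftc_s5 (h := fun x => f x * g1 x - f1 x * g x)
    (h' := fun x => (f1 x * g1 x + f x * g2 x) - (f2 x * g x + f1 x * g1 x))
    (fun x hx => ((h1 x hx).mul (k2 x hx)).sub ((h2 x hx).mul (k1 x hx))) (by fun_prop)
  have e : ∫ x in (0:ℝ)..π, ((f1 x * g1 x + f x * g2 x) - (f2 x * g x + f1 x * g1 x))
      = ∫ x in (0:ℝ)..π, (f x * g2 x - f2 x * g x) := by
    congr 1; ext x; ring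
  rw [e, intervalIntegral.integral_sub (aux_ii (by fun_prop)) (aux_ii (by fun_prop)),
    f0, fp, g0, gp] at this
  linarith

theorem aux_slice_s5 {f : ℝ → ℝ → ℝ} {t₀ : ℝ}
    (hc : ContinuousOn (Function.uncurry f) (Icc 0 π ×ˢ Ici t₀)) {s : ℝ} (hs : t₀ ≤ s) :
    ContinuousOn (fun x => f x s) (Icc 0 π) :=
  hc.comp (f := fun x => (x, s)) (by fun_prop) (fun x hx => ⟨hx, hs⟩)

theorem S_green {ε C F : ℝ → ℝ} {a' t₀ : ℝ} (S : ClassicalSolution ε C F a' t₀) {t : ℝ}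
    (ht : t₀ ≤ t) :
    ∫ x in (0:ℝ)..π, S.ux x t ^ 2 = - ∫ x in (0:ℝ)..π, S.u x t * S.uxx x t :=
  aux_green (S.hux t ht) (S.huxx t ht) (aux_slice_s5 S.cont_uxx ht) (S.bc0 t ht) (S.bcπ t ht)

theorem S_wirt {ε C F : ℝ → ℝ} {a' t₀ : ℝ} (S : ClassicalSolution ε C F a' t₀) {t : ℝ}
    (ht : t₀ ≤ t) :
    ∫ x in (0:ℝ)..π, S.u x t ^ 2 ≤ ∫ x in (0:ℝ)..π, S.ux x t ^ 2 :=
  aux_wirt (S.hux t ht) (aux_slice_s5 S.cont_ux ht) (S.bc0 t ht) (S.bcπ t ht)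

theorem S_sym {ε C F : ℝ → ℝ} {a' t₀ : ℝ} (S : ClassicalSolution ε C F a' t₀) {t : ℝ}
    (ht : t₀ ≤ t) :
    ∫ x in (0:ℝ)..π, S.u x t * S.uxxt x t = ∫ x in (0:ℝ)..π, S.ut x t * S.uxx x t := by
  have cu : ContinuousOn (fun p : ℝ × ℝ => S.u p.1 p.2) (Icc 0 π ×ˢ Ici t₀) := S.cont_u
  have cut : ContinuousOn (fun p : ℝ × ℝ => S.ut p.1 p.2) (Icc 0 π ×ˢ Ici t₀) := S.cont_ut
  have cuxx : ContinuousOn (fun p : ℝ × ℝ => S.uxx p.1 p.2) (Icc 0 π ×ˢ Ici t₀) := S.cont_uxx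
  have cuxxt : ContinuousOn (fun p : ℝ × ℝ => S.uxxt p.1 p.2) (Icc 0 π ×ˢ Ici t₀) := S.cont_uxxt
  have c1 : ContinuousOn (fun p : ℝ × ℝ => S.u p.1 t) (Icc 0 π ×ˢ Ici t₀) :=
    (aux_slice_s5 S.cont_u ht).comp (f := Prod.fst) (by fun_prop) (fun p hp => hp.1)
  have c2 : ContinuousOn (fun p : ℝ × ℝ => S.uxx p.1 t) (Icc 0 π ×ˢ Ici t₀) :=
    (aux_slice_s5 S.cont_uxx ht).comp (f := Prod.fst) (by fun_prop) (fun p hp => hp.1)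
  have d1 := aux_diff (f := fun x s => S.u x t * S.uxx x s)
    (ft := fun x s => S.u x t * S.uxxt x s) ht
    (fun x hx s hs => (S.huxxt x hx s hs).const_mul _) (c1.mul cuxx) (c1.mul cuxxt)
  have d2 := aux_diff (f := fun x s => S.u x s * S.uxx x t)
    (ft := fun x s => S.ut x s * S.uxx x t) ht
    (fun x hx s hs => (S.hut x hx s hs).mul_const _) (cu.mul c2) (cut.mul c2)
  have e : ∀ s ∈ Ici t₀, ∫ x in (0:ℝ)..π, S.u x t * S.uxx x s
      = ∫ x in (0:ℝ)..π, S.u x s * S.uxx x t := by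
    intro s hs
    rw [aux_green_sym (S.hux t ht) (S.huxx t ht) (aux_slice_s5 S.cont_uxx ht) (S.bc0 t ht)
      (S.bcπ t ht) (S.hux s hs) (S.huxx s hs) (aux_slice_s5 S.cont_uxx hs) (S.bc0 s hs)
      (S.bcπ s hs)]
    congr 1; ext x; ring
  exact (uniqueDiffOn_Ici t₀ t ht).eq_deriv _ d1 (d2.congr e (e t ht))

theorem S_wirt_t {ε C F : ℝ → ℝ} {a' t₀ : ℝ} (S : ClassicalSolution ε C F a' t₀) {t : ℝ}
    (ht : t₀ ≤ t) :
    ∫ x in (0:ℝ)..π, S.ut x t * S.uxxt x t ≤ - ∫ x in (0:ℝ)..π, S.ut x t ^ 2 := by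
  have l1 := aux_slope_mul ht S.hut S.cont_u S.cont_ut S.huxxt S.cont_uxx S.cont_uxxt
  have l2 := aux_slope_mul ht S.hut S.cont_u S.cont_ut S.hut S.cont_u S.cont_ut
  have : (nhdsWithin t (Ici t₀ \ {t})).NeBot := by
    refine NeBot.mono (inferInstance : (nhdsWithin t (Ioi t)).NeBot) (nhdsWithin_mono _ ?_)
    intro s hs
    exact ⟨ht.trans (le_of_lt hs), ne_of_gt hs⟩
  simp only [pow_two]
  refine le_of_tendsto_of_tendsto l1 l2.neg ?_
  filter_upwards [self_mem_nhdsWithin] with s hs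
  have hs' : t₀ ≤ s := hs.1
  have h1 : ∀ x ∈ Icc (0:ℝ) π, HasDerivWithinAt (fun x => slope (S.u x) t s)
      ((S.ux x s - S.ux x t) / (s - t)) (Icc 0 π) x := by
    intro x hx
    simp only [slope_def_field]
    exact ((S.hux s hs' x hx).sub (S.hux t ht x hx)).div_const _
  have h2 : ∀ x ∈ Icc (0:ℝ) π, HasDerivWithinAt (fun x => (S.ux x s - S.ux x t) / (s - t))
      (slope (S.uxx x) t s) (Icc 0 π) x := by
    intro x hx
    simp only [slope_def_field]
    exact ((S.huxx s hs' x hx).sub (S.huxx t ht x hx)).div_const _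
  have c2 : ContinuousOn (fun x => slope (S.uxx x) t s) (Icc 0 π) := by
    simp only [slope_def_field]
    exact ((aux_slice_s5 S.cont_uxx hs').sub (aux_slice_s5 S.cont_uxx ht)).div_const _
  have b0 : slope (S.u 0) t s = 0 := by
    rw [slope_def_field, S.bc0 s hs', S.bc0 t ht]; simp
  have b1 : slope (S.u π) t s = 0 := by
    rw [slope_def_field, S.bcπ s hs', S.bcπ t ht]; simp
  have g := aux_green h1 h2 c2 b0 b1
  have w := aux_wirt h1 (fun x hx => (h2 x hx).continuousWithinAt) b0 b1
  simp only [pow_two] at g w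
  linarith

theorem S_F {ε C F : ℝ → ℝ} {a' t₀ : ℝ} (S : ClassicalSolution ε C F a' t₀) {t : ℝ}
    (ht : t₀ ≤ t) {F' : ℝ → ℝ} {k : ℝ} (hFderiv : ∀ z, HasDerivAt F (F' z) z)
    (hF'cont : Continuous F') (hF0 : F 0 = 0) (hFk : ∀ z, F' z ≤ k) :
    - ∫ x in (0:ℝ)..π, F (S.u x t) * S.uxx x t ≤ k * ∫ x in (0:ℝ)..π, S.ux x t ^ 2 := by
  have cF : Continuous F := continuous_iff_continuousAt.2 fun z => (hFderiv z).continuousAt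
  have cu := aux_slice_s5 S.cont_u ht
  have cux := aux_slice_s5 S.cont_ux ht
  have cuxx := aux_slice_s5 S.cont_uxx ht
  have e := aux_ftc_s5 (h := fun x => F (S.u x t) * S.ux x t)
    (h' := fun x => (F' (S.u x t) * S.ux x t) * S.ux x t + F (S.u x t) * S.uxx x t)
    (fun x hx => ((hFderiv (S.u x t)).comp_hasDerivWithinAt x (S.hux t ht x hx)).mul
      (S.huxx t ht x hx)) (by fun_prop)
  rw [S.bc0 t ht, S.bcπ t ht, hF0,
    intervalIntegral.integral_add (aux_ii (by fun_prop)) (aux_ii (by fun_prop))] at e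
  have : ∫ x in (0:ℝ)..π, (F' (S.u x t) * S.ux x t) * S.ux x t
      ≤ ∫ x in (0:ℝ)..π, k * S.ux x t ^ 2 := by
    apply intervalIntegral.integral_mono_on pi_pos.le (aux_ii (by fun_prop)) (aux_ii (by fun_prop))
    intro x _
    nlinarith [hFk (S.u x t), sq_nonneg (S.ux x t)]
  rw [intervalIntegral.integral_const_mul] at this
  linarith

theorem S_sup {ε C F : ℝ → ℝ} {a' t₀ : ℝ} (S : ClassicalSolution ε C F a' t₀) {t : ℝ}
    (ht : t₀ ≤ t) {x : ℝ} (hx : x ∈ Icc 0 π) :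
    |S.u x t| ≤ π + ∫ x in (0:ℝ)..π, S.ux x t ^ 2 := by
  have cux := aux_slice_s5 S.cont_ux ht
  have cu := aux_slice_s5 S.cont_u ht
  have e : ∫ y in (0:ℝ)..x, S.ux y t = S.u x t - S.u 0 t := by
    apply intervalIntegral.integral_eq_sub_of_hasDerivAt_of_le hx.1
    · exact cu.mono (Icc_subset_Icc_right hx.2)
    · exact fun y hy => (S.hux t ht y ⟨hy.1.le, hy.2.le.trans hx.2⟩).hasDerivAt
        (Icc_mem_nhds hy.1 (hy.2.trans_le hx.2))
    · exact ContinuousOn.intervalIntegrable (by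
        rw [uIcc_of_le hx.1]; exact cux.mono (Icc_subset_Icc_right hx.2))
  rw [S.bc0 t ht, sub_zero] at e
  rw [← e]
  calc |∫ y in (0:ℝ)..x, S.ux y t| ≤ ∫ y in (0:ℝ)..x, |S.ux y t| :=
        intervalIntegral.abs_integral_le_integral_abs hx.1
    _ ≤ ∫ y in (0:ℝ)..π, |S.ux y t| := by
        apply intervalIntegral.integral_mono_interval le_rfl hx.1 hx.2
        · exact Eventually.of_forall fun y => abs_nonneg _
        · exact aux_ii cux.abs
    _ ≤ ∫ y in (0:ℝ)..π, (1 + S.ux y t ^ 2) := by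
        apply intervalIntegral.integral_mono_on pi_pos.le (aux_ii cux.abs) (aux_ii (by fun_prop))
        intro y _
        rw [abs_le]; constructor <;> nlinarith [sq_nonneg (S.ux y t - 1), sq_nonneg (S.ux y t + 1)]
    _ = _ := by
        rw [intervalIntegral.integral_add (aux_ii (by fun_prop)) (aux_ii (by fun_prop))]
        simp

theorem S_d_sq {ε C F : ℝ → ℝ} {a' t₀ : ℝ} (S : ClassicalSolution ε C F a' t₀) {t : ℝ}
    (ht : t₀ ≤ t) :
    S.d t ^ 2 = (ε t) ^ 2 * (∫ x in (0:ℝ)..π, S.uxx x t ^ 2) + (∫ x in (0:ℝ)..π, S.ux x t ^ 2)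
      + (∫ x in (0:ℝ)..π, S.u x t ^ 2) + ∫ x in (0:ℝ)..π, S.ut x t ^ 2 := by
  have cux := aux_slice_s5 S.cont_ux ht
  have cu := aux_slice_s5 S.cont_u ht
  have cut := aux_slice_s5 S.cont_ut ht
  have cuxx := aux_slice_s5 S.cont_uxx ht
  rw [ClassicalSolution.d, Real.sq_sqrt
    (intervalIntegral.integral_nonneg pi_pos.le (fun x _ => by positivity)),
    intervalIntegral.integral_add (aux_ii (by fun_prop)) (aux_ii (by fun_prop)),
    intervalIntegral.integral_add (aux_ii (by fun_prop)) (aux_ii (by fun_prop)),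
    intervalIntegral.integral_add (aux_ii (by fun_prop)) (aux_ii (by fun_prop)),
    intervalIntegral.integral_const_mul]

theorem S_pde {ε C F : ℝ → ℝ} {a' t₀ : ℝ} (S : ClassicalSolution ε C F a' t₀)
    (h0 : 0 ≤ t₀) (cε : ContinuousOn ε (Ici 0)) (cC : ContinuousOn C (Ici 0)) (cF : Continuous F)
    {t : ℝ} (ht : t₀ ≤ t) {x : ℝ} (hx : x ∈ Icc 0 π) :
    S.utt x t = ε t * S.uxxt x t + C t * S.uxx x t - a' * S.ut x t
      + F (S.u x t) - S.aa x t * S.ut x t := by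
  have cu : ContinuousOn (fun p : ℝ × ℝ => S.u p.1 p.2) (Icc 0 π ×ˢ Ici t₀) := S.cont_u
  have cut : ContinuousOn (fun p : ℝ × ℝ => S.ut p.1 p.2) (Icc 0 π ×ˢ Ici t₀) := S.cont_ut
  have cutt : ContinuousOn (fun p : ℝ × ℝ => S.utt p.1 p.2) (Icc 0 π ×ˢ Ici t₀) := S.cont_utt
  have caa : ContinuousOn (fun p : ℝ × ℝ => S.aa p.1 p.2) (Icc 0 π ×ˢ Ici t₀) := S.cont_aa
  have cuxx : ContinuousOn (fun p : ℝ × ℝ => S.uxx p.1 p.2) (Icc 0 π ×ˢ Ici t₀) := S.cont_uxx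
  have cuxxt : ContinuousOn (fun p : ℝ × ℝ => S.uxxt p.1 p.2) (Icc 0 π ×ˢ Ici t₀) := S.cont_uxxt
  have cε' : ContinuousOn (fun p : ℝ × ℝ => ε p.2) (Icc 0 π ×ˢ Ici t₀) :=
    cε.comp (f := Prod.snd) (by fun_prop) (fun p hp => h0.trans hp.2)
  have cC' : ContinuousOn (fun p : ℝ × ℝ => C p.2) (Icc 0 π ×ˢ Ici t₀) :=
    cC.comp (f := Prod.snd) (by fun_prop) (fun p hp => h0.trans hp.2)
  have key : EqOn (fun p : ℝ × ℝ => S.utt p.1 p.2) (fun p : ℝ × ℝ =>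
      ε p.2 * S.uxxt p.1 p.2 + C p.2 * S.uxx p.1 p.2 - a' * S.ut p.1 p.2
      + F (S.u p.1 p.2) - S.aa p.1 p.2 * S.ut p.1 p.2) (Ioo 0 π ×ˢ Ioi t₀) := by
    intro p hp
    have := S.pde p.1 hp.1 p.2 hp.2
    simp only
    linarith
  have := key.of_subset_closure cutt (by
      have cFu : ContinuousOn (fun p : ℝ × ℝ => F (S.u p.1 p.2))
        (Icc 0 π ×ˢ Ici t₀) := cF.comp_continuousOn cu
      (repeat' first | assumption | exact continuousOn_const | apply ContinuousOn.sub | apply ContinuousOn.add | apply ContinuousOn.mul | apply ContinuousOn.pow))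
    (prod_mono Ioo_subset_Icc_self Ioi_subset_Ici_self) (by
      rw [closure_prod_eq, closure_Ioo pi_pos.ne, closure_Ioi])
  exact this (show (x, t) ∈ Icc 0 π ×ˢ Ici t₀ from ⟨hx, ht⟩)

theorem Phi_le {F F' : ℝ → ℝ} {k : ℝ} (hFderiv : ∀ z, HasDerivAt F (F' z) z)
    (hF0 : F 0 = 0) (hFk : ∀ z, F' z ≤ k) :
    (∀ z, z * F z ≤ k * z ^ 2) ∧ ∀ z, ∫ s in (0:ℝ)..z, F s ≤ k / 2 * z ^ 2 := by
  have cF : Continuous F := continuous_iff_continuousAt.2 fun z => (hFderiv z).continuousAt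
  have hm : Monotone (fun z => k * z - F z) := by
    apply monotone_of_hasDerivAt_nonneg (f' := fun z => k - F' z)
    · intro z
      exact (((hasDerivAt_id z).const_mul k).sub (hFderiv z)).congr_deriv (by simp)
    · intro z; simpa using hFk z
  have hpos : ∀ z, 0 ≤ z → F z ≤ k * z := by
    intro z hz; have := hm hz; simp [hF0] at this; exact this
  have hneg : ∀ z, z ≤ 0 → k * z ≤ F z := by
    intro z hz; have := hm hz; simp [hF0] at this; exact this
  refine ⟨fun z => ?_, fun z => ?_⟩
  · rcases le_total 0 z with h | h
    · nlinarith [hpos z h]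
    · nlinarith [hneg z h]
  · have e : ∀ a b : ℝ, ∫ s in a..b, k * s = k / 2 * (b ^ 2 - a ^ 2) := by
      intro a b; rw [intervalIntegral.integral_const_mul, integral_id]; ring
    rcases le_total 0 z with h | h
    · have := intervalIntegral.integral_mono_on (μ := volume) h (cF.intervalIntegrable 0 z)
        ((by fun_prop : Continuous fun s => k * s).intervalIntegrable 0 z)
        (fun s hs => hpos s hs.1)
      rw [e] at this; linarith
    · have := intervalIntegral.integral_mono_on (μ := volume) h
        ((by fun_prop : Continuous fun s => k * s).intervalIntegrable z 0)
        (cF.intervalIntegrable z 0)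
        (fun s hs => hneg s hs.2)
      rw [e] at this; rw [intervalIntegral.integral_symm]; linarith

theorem Phi_ge {F F' : ℝ → ℝ} (hFderiv : ∀ z, HasDerivAt F (F' z) z)
    (hF'cont : Continuous F') (hF0 : F 0 = 0) (r : ℝ) :
    ∃ L, 0 ≤ L ∧ ∀ z, |z| ≤ r → - ∫ s in (0:ℝ)..z, F s ≤ L * z ^ 2 := by
  obtain ⟨L, hL⟩ := (isCompact_Icc (a := -r) (b := r)).exists_bound_of_continuousOn
    hF'cont.continuousOn
  refine ⟨max L 0, le_max_right _ _, fun z hz => ?_⟩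
  have hz0 := abs_nonneg z
  have hF : ∀ s, |s| ≤ r → |F s| ≤ max L 0 * |s| := by
    intro s hs
    have := (convex_Icc (-r) r).norm_image_sub_le_of_norm_hasDerivWithin_le
      (f := F) (f' := F') (C := max L 0) (x := 0) (y := s)
      (fun y _ => (hFderiv y).hasDerivWithinAt)
      (fun y hy => (hL y hy).trans (le_max_left _ _)) ⟨by linarith, by linarith⟩ (abs_le.mp hs)
    simpa [hF0] using this
  have := intervalIntegral.norm_integral_le_of_norm_le_const (f := F) (a := 0) (b := z)
    (C := max L 0 * |z|) (by
      intro s hs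
      have hsz : |s| ≤ |z| := by
        rcases le_total 0 z with h | h
        · rw [uIoc_of_le h] at hs
          rw [abs_of_nonneg hs.1.le, abs_of_nonneg h]; exact hs.2
        · rw [uIoc_of_ge h] at hs
          rw [abs_of_nonpos hs.2, abs_of_nonpos h]; linarith [hs.1]
      exact (hF s (hsz.trans hz)).trans (by gcongr))
  rw [sub_zero, mul_assoc, abs_mul_abs_self, Real.norm_eq_abs] at this
  have h2 := neg_abs_le (∫ s in (0:ℝ)..z, F s)
  nlinarith

/-- Integrand of the Liapunov functional (with `u_x^2` replaced by `-u u_xx`). -/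
noncomputable def wI {ε C F : ℝ → ℝ} {a' t₀ : ℝ} (S : ClassicalSolution ε C F a' t₀)
    (ε' : ℝ → ℝ) (γ θ : ℝ) (x t : ℝ) : ℝ :=
  γ / 2 * S.ut x t ^ 2 + 1 / 2 * (ε t * S.uxx x t - S.ut x t) ^ 2
    - 1 / 2 * (C t * (1 + γ) - ε' t + ε t * (a' + θ)) * (S.u x t * S.uxx x t)
    + 1 / 2 * a' * θ * S.u x t ^ 2 + θ * (S.u x t * S.ut x t)
    - (1 + γ) * ∫ s in (0:ℝ)..(S.u x t), F s

noncomputable def wT {ε C F : ℝ → ℝ} {a' t₀ : ℝ} (S : ClassicalSolution ε C F a' t₀)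
    (ε' ε'' C' : ℝ → ℝ) (γ θ : ℝ) (x t : ℝ) : ℝ :=
  γ * (S.ut x t * S.utt x t)
    + (ε t * S.uxx x t - S.ut x t) * (ε' t * S.uxx x t + ε t * S.uxxt x t - S.utt x t)
    - 1 / 2 * (C' t * (1 + γ) - ε'' t + ε' t * (a' + θ)) * (S.u x t * S.uxx x t)
    - 1 / 2 * (C t * (1 + γ) - ε' t + ε t * (a' + θ))
      * (S.ut x t * S.uxx x t + S.u x t * S.uxxt x t)
    + a' * θ * (S.u x t * S.ut x t) + θ * (S.ut x t * S.ut x t + S.u x t * S.utt x t)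
    - (1 + γ) * (F (S.u x t) * S.ut x t)

theorem cont_snd {h : ℝ → ℝ} {t₀ : ℝ} (h0 : 0 ≤ t₀) (c : ContinuousOn h (Ici 0)) :
    ContinuousOn (fun p : ℝ × ℝ => h p.2) (Icc 0 π ×ˢ Ici t₀) :=
  c.comp (f := Prod.snd) (by fun_prop) (fun p hp => h0.trans hp.2)

theorem W_deriv {ε C F : ℝ → ℝ} {a' t₀ : ℝ} (S : ClassicalSolution ε C F a' t₀)
    (h0 : 0 ≤ t₀) {ε' ε'' C' : ℝ → ℝ} (γ θ : ℝ)
    (hεderiv : ∀ t ∈ Ici (0:ℝ), HasDerivWithinAt ε (ε' t) (Ici 0) t)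
    (hε'deriv : ∀ t ∈ Ici (0:ℝ), HasDerivWithinAt ε' (ε'' t) (Ici 0) t)
    (hε''cont : ContinuousOn ε'' (Ici 0))
    (hCderiv : ∀ t ∈ Ici (0:ℝ), HasDerivWithinAt C (C' t) (Ici 0) t)
    (hC'cont : ContinuousOn C' (Ici 0)) (cF : Continuous F)
    {t : ℝ} (ht : t₀ ≤ t) :
    HasDerivWithinAt (fun s => ∫ x in (0:ℝ)..π, wI S ε' γ θ x s)
      (∫ x in (0:ℝ)..π, wT S ε' ε'' C' γ θ x t) (Ici t₀) t := by
  have cu : ContinuousOn (fun p : ℝ × ℝ => S.u p.1 p.2) (Icc 0 π ×ˢ Ici t₀) := S.cont_u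
  have cut : ContinuousOn (fun p : ℝ × ℝ => S.ut p.1 p.2) (Icc 0 π ×ˢ Ici t₀) := S.cont_ut
  have cutt : ContinuousOn (fun p : ℝ × ℝ => S.utt p.1 p.2) (Icc 0 π ×ˢ Ici t₀) := S.cont_utt
  have cuxx : ContinuousOn (fun p : ℝ × ℝ => S.uxx p.1 p.2) (Icc 0 π ×ˢ Ici t₀) := S.cont_uxx
  have cuxxt : ContinuousOn (fun p : ℝ × ℝ => S.uxxt p.1 p.2) (Icc 0 π ×ˢ Ici t₀) := S.cont_uxxt
  have cε := cont_snd h0 (fun s hs => (hεderiv s hs).continuousWithinAt)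
  have cε' := cont_snd h0 (fun s hs => (hε'deriv s hs).continuousWithinAt)
  have cC := cont_snd h0 (fun s hs => (hCderiv s hs).continuousWithinAt)
  have cε'' := cont_snd h0 hε''cont
  have cC' := cont_snd h0 hC'cont
  have hPhi : ∀ z, HasDerivAt (fun z => ∫ s in (0:ℝ)..z, F s) (F z) z := fun z =>
    intervalIntegral.integral_hasDerivAt_right (cF.intervalIntegrable _ _)
      (cF.stronglyMeasurableAtFilter _ _) cF.continuousAt
  have cPhi : Continuous (fun z => ∫ s in (0:ℝ)..z, F s) :=
    continuous_iff_continuousAt.2 fun z => (hPhi z).continuousAt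
  have cPhiu : ContinuousOn (fun p : ℝ × ℝ => ∫ s in (0:ℝ)..(S.u p.1 p.2), F s)
    (Icc 0 π ×ˢ Ici t₀) := cPhi.comp_continuousOn cu
  have cFu : ContinuousOn (fun p : ℝ × ℝ => F (S.u p.1 p.2))
    (Icc 0 π ×ˢ Ici t₀) := cF.comp_continuousOn cu
  clear hε''cont hC'cont
  refine aux_diff (f := wI S ε' γ θ) (ft := wT S ε' ε'' C' γ θ) ht ?_ ?_ ?_
  · intro x hx s hs
    have hs0 : s ∈ Ici (0:ℝ) := h0.trans hs
    have sub : Ici t₀ ⊆ Ici 0 := Ici_subset_Ici.2 h0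
    have dε := (hεderiv s hs0).mono sub
    have dε' := (hε'deriv s hs0).mono sub
    have dC := (hCderiv s hs0).mono sub
    have du := S.hut x hx s hs
    have dut := S.hutt x hx s hs
    have duxx := S.huxxt x hx s hs
    have dP := (hPhi (S.u x s)).comp_hasDerivWithinAt s du
    have := (((((dut.pow 2).const_mul (γ / 2)).add
      ((((dε.mul duxx).sub dut).pow 2).const_mul (1 / 2))).sub
      (((((dC.mul_const (1 + γ)).sub dε').add (dε.mul_const (a' + θ))).const_mul (1 / 2)).mul
        (du.mul duxx))).add ((du.pow 2).const_mul (1 / 2 * a' * θ))).add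
      ((du.mul dut).const_mul θ) |>.sub (dP.const_mul (1 + γ))
    refine this.congr_deriv ?_
    simp only [wT, Pi.mul_apply, Pi.sub_apply, Pi.add_apply]
    push_cast
    ring
  · simp only [Function.uncurry_def, wI]
    (repeat' first | assumption | exact continuousOn_const | apply ContinuousOn.sub | apply ContinuousOn.add | apply ContinuousOn.mul | apply ContinuousOn.pow)
  · simp only [Function.uncurry_def, wT]
    (repeat' first | assumption | exact continuousOn_const | apply ContinuousOn.sub | apply ContinuousOn.add | apply ContinuousOn.mul | apply ContinuousOn.pow)

set_option maxHeartbeats 1600000 in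
theorem W_bounds {ε C F : ℝ → ℝ} {a' t₀ : ℝ} (S : ClassicalSolution ε C F a' t₀)
    {ε' : ℝ → ℝ} {γ θ k Cb μ : ℝ} (cF : Continuous F) {t : ℝ} (ht : t₀ ≤ t)
    (ha' : 0 ≤ a') (hθ : 0 ≤ θ) (hk : 0 ≤ k) (hCb : 0 < Cb) (hkC : k ≤ Cb) (hμ : 0 < μ)
    (hmuk : 0 < μ + Cb / 2 - 2 * k)
    (hγ : 2 + 4 * θ ^ 2 / Cb ≤ γ) (hε : 0 ≤ ε t) (hC : Cb ≤ C t)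
    (hdiss : μ * (1 + ε t) ≤ C t - ε' t)
    (hPhi : ∀ z, ∫ s in (0:ℝ)..z, F s ≤ k / 2 * z ^ 2) :
    min (1 / 4) (Cb / 16) * S.d t ^ 2 ≤ (∫ x in (0:ℝ)..π, wI S ε' γ θ x t) ∧
    ∀ N C0 L r, 0 ≤ N → 0 ≤ L → C t ≤ C0 → - ε' t ≤ N → S.d t ≤ r →
      (∀ z, |z| ≤ π + r ^ 2 → - ∫ s in (0:ℝ)..z, F s ≤ L * z ^ 2) →
      (∫ x in (0:ℝ)..π, wI S ε' γ θ x t) ≤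
        (1 + γ) * ((1 + C0 + N + a' + θ + a' * θ) + L) * S.d t ^ 2 := by
  have cu := aux_slice_s5 S.cont_u ht
  have cut := aux_slice_s5 S.cont_ut ht
  have cux := aux_slice_s5 S.cont_ux ht
  have cuxx := aux_slice_s5 S.cont_uxx ht
  have cPhi : Continuous (fun z => ∫ s in (0:ℝ)..z, F s) :=
    continuous_iff_continuousAt.2 fun z => (intervalIntegral.integral_hasDerivAt_right
      (cF.intervalIntegrable _ _) (cF.stronglyMeasurableAtFilter _ _) cF.continuousAt).continuousAt
  have cPhiu : ContinuousOn (fun x : ℝ => ∫ s in (0:ℝ)..(S.u x t), F s)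
    (Icc 0 π) := cPhi.comp_continuousOn cu
  have cw : ContinuousOn (fun x => wI S ε' γ θ x t) (Icc 0 π) := by
    simp only [wI]; fun_prop
  have hY := S_green S ht
  have hUY := S_wirt S ht
  have hsup := fun x hx => S_sup S ht (x := x) hx
  have hd := S_d_sq S ht
  have hd0 : 0 ≤ S.d t := Real.sqrt_nonneg _
  have hU : 0 ≤ ∫ x in (0:ℝ)..π, S.u x t ^ 2 :=
    intervalIntegral.integral_nonneg pi_pos.le (fun x _ => sq_nonneg _)
  have hP : 0 ≤ ∫ x in (0:ℝ)..π, S.ut x t ^ 2 :=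
    intervalIntegral.integral_nonneg pi_pos.le (fun x _ => sq_nonneg _)
  have hZ : 0 ≤ ∫ x in (0:ℝ)..π, S.uxx x t ^ 2 :=
    intervalIntegral.integral_nonneg pi_pos.le (fun x _ => sq_nonneg _)
  have lin : ∀ c1 c2 c3 c4 : ℝ, ∫ x in (0:ℝ)..π, (c1 * (S.u x t * S.uxx x t)
      + c2 * S.uxx x t ^ 2 + c3 * S.ut x t ^ 2 + c4 * S.u x t ^ 2) =
      - c1 * (∫ x in (0:ℝ)..π, S.ux x t ^ 2) + c2 * (∫ x in (0:ℝ)..π, S.uxx x t ^ 2)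
      + c3 * (∫ x in (0:ℝ)..π, S.ut x t ^ 2) + c4 * (∫ x in (0:ℝ)..π, S.u x t ^ 2) := by
    intro c1 c2 c3 c4
    rw [intervalIntegral.integral_add (aux_ii (by fun_prop)) (aux_ii (by fun_prop)),
      intervalIntegral.integral_add (aux_ii (by fun_prop)) (aux_ii (by fun_prop)),
      intervalIntegral.integral_add (aux_ii (by fun_prop)) (aux_ii (by fun_prop)), hY]
    simp only [intervalIntegral.integral_const_mul]
    ring
  have hθC : 0 ≤ 4 * θ ^ 2 / Cb := by positivity
  have hγ2 : 2 ≤ γ := by linarith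
  set G := C t * (1 + γ) - ε' t + ε t * (a' + θ) with hG
  set e := ε t with he
  constructor
  · have h1 : ∫ x in (0:ℝ)..π, ((- 1 / 2 * G) * (S.u x t * S.uxx x t)
        + (e ^ 2 / 4) * S.uxx x t ^ 2 + (1 / 2) * S.ut x t ^ 2
        + (- (Cb / 8 + (1 + γ) * k / 2)) * S.u x t ^ 2) ≤ ∫ x in (0:ℝ)..π, wI S ε' γ θ x t := by
      apply intervalIntegral.integral_mono_on pi_pos.le (aux_ii (by fun_prop)) (aux_ii cw)
      intro x _
      simp only [wI, ← hG, ← he]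
      have hp := mul_le_mul_of_nonneg_left (hPhi (S.u x t)) (show 0 ≤ 1 + γ by linarith)
      generalize S.u x t = u at *
      generalize S.ut x t = v at *
      generalize S.uxx x t = z at *
      have q1 : 0 ≤ (e * z - 2 * v) ^ 2 := sq_nonneg _
      have q2 : 0 ≤ Cb / 8 * u ^ 2 + θ * (u * v) + (2 * θ ^ 2 / Cb) * v ^ 2 := by
        have : Cb / 8 * u ^ 2 + θ * (u * v) + (2 * θ ^ 2 / Cb) * v ^ 2
          = (Cb * u + 4 * θ * v) ^ 2 / (8 * Cb) := by field_simp; ring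
        rw [this]; positivity
      have q3 : 0 ≤ (γ - (2 + 4 * θ ^ 2 / Cb)) * v ^ 2 :=
        mul_nonneg (by linarith) (sq_nonneg _)
      have q4 : 0 ≤ a' * θ * u ^ 2 := by positivity
      have q5 : 4 * θ ^ 2 / Cb = 2 * (2 * θ ^ 2 / Cb) := by ring
      rw [q5] at q3
      generalize 2 * θ ^ 2 / Cb = m at *
      linarith
    rw [lin] at h1
    refine le_trans ?_ h1
    rw [hd]
    generalize (∫ x in (0:ℝ)..π, S.ux x t ^ 2) = Y at *
    generalize (∫ x in (0:ℝ)..π, S.u x t ^ 2) = U at *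
    generalize (∫ x in (0:ℝ)..π, S.ut x t ^ 2) = P at *
    generalize (∫ x in (0:ℝ)..π, S.uxx x t ^ 2) = Z at *
    have m1 : min (1 / 4) (Cb / 16) ≤ 1 / 4 := min_le_left _ _
    have m2 : min (1 / 4) (Cb / 16) ≤ Cb / 16 := min_le_right _ _
    generalize min (1 / 4) (Cb / 16) = m at *
    have g1 : Cb / 2 + (1 + γ) * k ≤ G := by
      have : 0 ≤ e * (a' + θ) := by positivity
      have : 0 ≤ μ * e := by positivity
      nlinarith
    have b1 := mul_le_mul_of_nonneg_right m1 (show 0 ≤ e ^ 2 * Z by positivity)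
    have b2 := mul_le_mul_of_nonneg_right m1 hP
    have b3 := mul_le_mul_of_nonneg_right m2 hU
    have b4 := mul_le_mul_of_nonneg_right m2 (hU.trans hUY)
    have b5 := mul_le_mul_of_nonneg_right g1 (hU.trans hUY)
    have b6 := mul_le_mul_of_nonneg_left hUY
      (show 0 ≤ Cb / 16 + (Cb / 8 + (1 + γ) * k / 2) by positivity)
    linarith
  · intro N C0 L r hN hL hC0 hεN hdr hLz
    have hYd : (∫ x in (0:ℝ)..π, S.ux x t ^ 2) ≤ r ^ 2 := by
      have : 0 ≤ e ^ 2 * ∫ x in (0:ℝ)..π, S.uxx x t ^ 2 := by positivity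
      have : S.d t ^ 2 ≤ r ^ 2 := by gcongr
      linarith
    have h1 : ∫ x in (0:ℝ)..π, wI S ε' γ θ x t ≤ ∫ x in (0:ℝ)..π,
        ((- 1 / 2 * G) * (S.u x t * S.uxx x t)
        + (e ^ 2) * S.uxx x t ^ 2 + (γ / 2 + 1 + θ / 2) * S.ut x t ^ 2
        + (1 / 2 * a' * θ + θ / 2 + (1 + γ) * L) * S.u x t ^ 2) := by
      apply intervalIntegral.integral_mono_on pi_pos.le (aux_ii cw) (aux_ii (by fun_prop))
      intro x hx
      simp only [wI, ← hG, ← he]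
      have hp := mul_le_mul_of_nonneg_left (hLz (S.u x t) ((hsup x hx).trans (by linarith)))
        (show 0 ≤ 1 + γ by linarith)
      generalize S.u x t = u at *
      generalize S.ut x t = v at *
      generalize S.uxx x t = z at *
      have q1 : 0 ≤ (e * z + v) ^ 2 := sq_nonneg _
      have q2 : 0 ≤ θ * (u - v) ^ 2 := by positivity
      linarith
    have h2 : ∫ x in (0:ℝ)..π, ((-e) * (S.u x t * S.uxx x t)
        + 0 * S.uxx x t ^ 2 + 0 * S.ut x t ^ 2
        + 0 * S.u x t ^ 2) ≤ ∫ x in (0:ℝ)..π, (0 * (S.u x t * S.uxx x t)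
        + (e ^ 2 / 2) * S.uxx x t ^ 2 + 0 * S.ut x t ^ 2
        + (1 / 2) * S.u x t ^ 2) := by
      apply intervalIntegral.integral_mono_on pi_pos.le (aux_ii (by fun_prop)) (aux_ii (by fun_prop))
      intro x hx
      nlinarith [sq_nonneg (e * S.uxx x t + S.u x t)]
    rw [lin] at h1
    rw [lin, lin] at h2
    refine h1.trans ?_
    rw [hd]
    generalize (∫ x in (0:ℝ)..π, S.ux x t ^ 2) = Y at *
    generalize (∫ x in (0:ℝ)..π, S.u x t ^ 2) = U at *
    generalize (∫ x in (0:ℝ)..π, S.ut x t ^ 2) = P at *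
    generalize (∫ x in (0:ℝ)..π, S.uxx x t ^ 2) = Z at *
    have hY0 : 0 ≤ Y := hU.trans hUY
    have hC00 : 0 ≤ C0 := by linarith
    have hZ' : 0 ≤ e ^ 2 * Z := by positivity
    have g1 : G * Y ≤ (C0 * (1 + γ) + N) * Y + (a' + θ) * (1 / 2 * (e ^ 2 * Z) + 1 / 2 * U) := by
      have i1 : C t * (1 + γ) - ε' t ≤ C0 * (1 + γ) + N := by
        have := mul_le_mul_of_nonneg_right hC0 (show 0 ≤ 1 + γ by linarith)
        linarith
      have i2 := mul_le_mul_of_nonneg_right i1 hY0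
      have i3 : (a' + θ) * (e * Y) ≤ (a' + θ) * (1 / 2 * (e ^ 2 * Z) + 1 / 2 * U) :=
        mul_le_mul_of_nonneg_left (by linarith) (by positivity)
      rw [hG]; linarith
    generalize e ^ 2 * Z = Z' at *
    have hγ0 : 0 ≤ γ := by linarith
    have k1 : (1 / 2) * (C0 * (1 + γ) + N) * Y
        ≤ (1 + γ) * ((1 + C0 + N + a' + θ + a' * θ) + L) * Y := by
      apply mul_le_mul_of_nonneg_right _ hY0
      have : 0 ≤ (1 / 2) * C0 * (1 + γ) + 1 / 2 * N + N * γ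
        + (1 + γ) * (1 + a' + θ + a' * θ + L) := by positivity
      linarith
    have k2 : (1 + (a' + θ) / 4) * Z'
        ≤ (1 + γ) * ((1 + C0 + N + a' + θ + a' * θ) + L) * Z' := by
      apply mul_le_mul_of_nonneg_right _ hZ'
      have : 0 ≤ (1 + γ) * (C0 + N + a' * θ + L) + γ * (1 + a' + θ)
        + 3 / 4 * (a' + θ) := by positivity
      linarith
    have k3 : (γ / 2 + 1 + θ / 2) * P
        ≤ (1 + γ) * ((1 + C0 + N + a' + θ + a' * θ) + L) * P := by
      apply mul_le_mul_of_nonneg_right _ hP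
      have : 0 ≤ (1 + γ) * (C0 + N + a' + a' * θ + L) + γ / 2 + θ / 2 + γ * θ := by positivity
      linarith
    have k4 : (1 / 2 * a' * θ + θ / 2 + (1 + γ) * L + (a' + θ) / 4) * U
        ≤ (1 + γ) * ((1 + C0 + N + a' + θ + a' * θ) + L) * U := by
      apply mul_le_mul_of_nonneg_right _ hU
      have : 0 ≤ (1 + γ) * (1 + C0 + N) + γ * (a' + θ + a' * θ) + 1 / 2 * a' * θ + θ / 4
        + 3 / 4 * a' := by positivity
      linarith
    linarith

set_option maxHeartbeats 1600000 in
theorem W_deriv_le {ε C F : ℝ → ℝ} {a' t₀ : ℝ} (S : ClassicalSolution ε C F a' t₀)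
    (h0 : 0 ≤ t₀) {ε' ε'' C' F' : ℝ → ℝ} {γ θ k μ M : ℝ}
    (cε : ContinuousOn ε (Ici 0)) (cC : ContinuousOn C (Ici 0))
    (hFderiv : ∀ z, HasDerivAt F (F' z) z)
    (hF'cont : Continuous F') (hF0 : F 0 = 0) (hFk : ∀ z, F' z ≤ k)
    {t : ℝ} (ht : t₀ ≤ t) (ha' : 0 ≤ a') (hθ : 0 ≤ θ) (hμ : 0 < μ) (hk : 0 ≤ k)
    (hγ0 : 0 ≤ γ)
    (haM : ∀ x ∈ Icc (0:ℝ) π, S.aa x t ≤ M) (hγM : M * (1 / (2 * μ) + θ ^ 2 / 4) ≤ γ)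
    (hε : 0 ≤ ε t) (hdiss : μ * (1 + ε t) ≤ C t - ε' t)
    (hγp : θ + 1 ≤ γ * (ε t + a'))
    (hYc : 1 / 2 * (C' t * (1 + γ) - ε'' t + ε' t * (a' + θ)) - θ * C t + ε t * k + θ * k + 1
      ≤ - 1) :
    (∫ x in (0:ℝ)..π, wT S ε' ε'' C' γ θ x t) ≤ - (min (1 / 2) (μ / 2)) * S.d t ^ 2 := by
  have cF : Continuous F := continuous_iff_continuousAt.2 fun z => (hFderiv z).continuousAt
  have cu := aux_slice_s5 S.cont_u ht
  have cut := aux_slice_s5 S.cont_ut ht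
  have cutt := aux_slice_s5 S.cont_utt ht
  have cux := aux_slice_s5 S.cont_ux ht
  have cuxx := aux_slice_s5 S.cont_uxx ht
  have cuxxt := aux_slice_s5 S.cont_uxxt ht
  have cw : ContinuousOn (fun x => wT S ε' ε'' C' γ θ x t) (Icc 0 π) := by
    simp only [wT]; fun_prop
  have hY := S_green S ht
  have hUY := S_wirt S ht
  have hsym := S_sym S ht
  have hwt := S_wirt_t S ht
  have hF := S_F S ht hFderiv hF'cont hF0 hFk
  have hd := S_d_sq S ht
  have hzF := (Phi_le hFderiv hF0 hFk).1
  have hpde := fun x hx => S_pde S h0 cε cC cF ht (x := x) hx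
  have hU : 0 ≤ ∫ x in (0:ℝ)..π, S.u x t ^ 2 :=
    intervalIntegral.integral_nonneg pi_pos.le (fun x _ => sq_nonneg _)
  have hP : 0 ≤ ∫ x in (0:ℝ)..π, S.ut x t ^ 2 :=
    intervalIntegral.integral_nonneg pi_pos.le (fun x _ => sq_nonneg _)
  have hZ : 0 ≤ ∫ x in (0:ℝ)..π, S.uxx x t ^ 2 :=
    intervalIntegral.integral_nonneg pi_pos.le (fun x _ => sq_nonneg _)
  have lin : ∀ c1 c2 c3 c4 c5 c6 c7 : ℝ, ∫ x in (0:ℝ)..π, (c1 * (S.u x t * S.uxx x t)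
      + c2 * S.uxx x t ^ 2 + c3 * S.ut x t ^ 2 + c4 * S.u x t ^ 2
      + c5 * (S.ut x t * S.uxxt x t) + c6 * (F (S.u x t) * S.uxx x t)
      + c7 * (S.u x t * S.uxxt x t - S.ut x t * S.uxx x t)) =
      - c1 * (∫ x in (0:ℝ)..π, S.ux x t ^ 2) + c2 * (∫ x in (0:ℝ)..π, S.uxx x t ^ 2)
      + c3 * (∫ x in (0:ℝ)..π, S.ut x t ^ 2) + c4 * (∫ x in (0:ℝ)..π, S.u x t ^ 2)
      + c5 * (∫ x in (0:ℝ)..π, S.ut x t * S.uxxt x t)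
      + c6 * (∫ x in (0:ℝ)..π, F (S.u x t) * S.uxx x t) := by
    intro c1 c2 c3 c4 c5 c6 c7
    rw [intervalIntegral.integral_add (aux_ii (by fun_prop)) (aux_ii (by fun_prop)),
      intervalIntegral.integral_add (aux_ii (by fun_prop)) (aux_ii (by fun_prop)),
      intervalIntegral.integral_add (aux_ii (by fun_prop)) (aux_ii (by fun_prop)),
      intervalIntegral.integral_add (aux_ii (by fun_prop)) (aux_ii (by fun_prop)),
      intervalIntegral.integral_add (aux_ii (by fun_prop)) (aux_ii (by fun_prop)),
      intervalIntegral.integral_add (aux_ii (by fun_prop)) (aux_ii (by fun_prop)), hY]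
    simp only [intervalIntegral.integral_const_mul]
    rw [intervalIntegral.integral_sub (aux_ii (by fun_prop)) (aux_ii (by fun_prop)), hsym]
    ring
  set G' := C' t * (1 + γ) - ε'' t + ε' t * (a' + θ) with hG'
  set e := ε t with he
  have h1 : (∫ x in (0:ℝ)..π, wT S ε' ε'' C' γ θ x t) ≤ ∫ x in (0:ℝ)..π,
      ((- (1 / 2 * G' - θ * C t)) * (S.u x t * S.uxx x t)
      + (- (μ / 2 * e ^ 2)) * S.uxx x t ^ 2 + (- (γ * a' - θ)) * S.ut x t ^ 2
      + (θ * k + 1) * S.u x t ^ 2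
      + (γ * e) * (S.ut x t * S.uxxt x t) + (- e) * (F (S.u x t) * S.uxx x t)
      + (θ * e - 1 / 2 * (C t * (1 + γ) - ε' t + e * (a' + θ)))
        * (S.u x t * S.uxxt x t - S.ut x t * S.uxx x t)) := by
    apply intervalIntegral.integral_mono_on pi_pos.le (aux_ii cw) (aux_ii (by fun_prop))
    intro x hx
    have hp := hpde x hx
    have ha := S.aa_nonneg x hx t ht
    have haM' := haM x hx
    have hz := mul_le_mul_of_nonneg_left (hzF (S.u x t)) hθ
    simp only [wT, ← hG', ← he, hp]
    generalize S.u x t = u at *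
    generalize S.ut x t = v at *
    generalize S.uxx x t = z at *
    generalize S.uxxt x t = y at *
    generalize S.aa x t = a at *
    generalize F u = f at *
    have q1 : 0 ≤ μ / 2 * e ^ 2 * z ^ 2 - e * a * z * v + 1 / (2 * μ) * (a ^ 2 * v ^ 2) := by
      have : μ / 2 * e ^ 2 * z ^ 2 - e * a * z * v + 1 / (2 * μ) * (a ^ 2 * v ^ 2)
        = (μ * e * z - a * v) ^ 2 / (2 * μ) := by field_simp; ring
      rw [this]; positivity
    have q2 : 0 ≤ (u + θ * a * v / 2) ^ 2 := sq_nonneg _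
    have q3 : a ^ 2 * (1 / (2 * μ) + θ ^ 2 / 4) * v ^ 2 ≤ a * γ * v ^ 2 := by
      apply mul_le_mul_of_nonneg_right _ (sq_nonneg _)
      have hs : 0 ≤ 1 / (2 * μ) + θ ^ 2 / 4 := by positivity
      have := mul_le_mul_of_nonneg_right haM' hs
      have := mul_le_mul_of_nonneg_left (this.trans hγM) ha
      linarith
    have q4 : μ * e ^ 2 * z ^ 2 ≤ e * (C t - ε' t) * z ^ 2 := by
      apply mul_le_mul_of_nonneg_right _ (sq_nonneg _)
      have := mul_le_mul_of_nonneg_left hdiss hε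
      have : 0 ≤ μ * e := by positivity
      linarith
    have q5 : 0 ≤ a' * v ^ 2 := by positivity
    have q6 : 0 ≤ a * v ^ 2 := by positivity
    generalize 1 / (2 * μ) = s at *
    linarith
  rw [lin] at h1
  refine h1.trans ?_
  rw [hd]
  generalize (∫ x in (0:ℝ)..π, S.ux x t ^ 2) = Y at *
  generalize (∫ x in (0:ℝ)..π, S.u x t ^ 2) = U at *
  generalize (∫ x in (0:ℝ)..π, S.ut x t ^ 2) = P at *
  generalize (∫ x in (0:ℝ)..π, S.uxx x t ^ 2) = Z at *
  generalize (∫ x in (0:ℝ)..π, S.ut x t * S.uxxt x t) = Q at *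
  generalize (∫ x in (0:ℝ)..π, F (S.u x t) * S.uxx x t) = V at *
  have hY0 : 0 ≤ Y := hU.trans hUY
  have m1 : min (1 / 2) (μ / 2) ≤ 1 / 2 := min_le_left _ _
  have m2 : min (1 / 2) (μ / 2) ≤ μ / 2 := min_le_right _ _
  generalize min (1 / 2) (μ / 2) = m at *
  have b1 := mul_le_mul_of_nonneg_right m2 (show 0 ≤ e ^ 2 * Z by positivity)
  have b2 := mul_le_mul_of_nonneg_right m1 hP
  have b3 := mul_le_mul_of_nonneg_right m1 hU
  have b4 := mul_le_mul_of_nonneg_right m1 hY0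
  have b5 := mul_le_mul_of_nonneg_left hwt (show 0 ≤ γ * e by positivity)
  have b6 := mul_le_mul_of_nonneg_left hF hε
  have b7 := mul_le_mul_of_nonneg_right hYc hY0
  have b8 := mul_le_mul_of_nonneg_left hUY (show 0 ≤ θ * k + 1 by positivity)
  have b9 := mul_le_mul_of_nonneg_right hγp hP
  linarith

/-- a lower bound on `(0,∞)` extends to `[0,∞)` -/
theorem ext_lb {f : ℝ → ℝ} {c : ℝ} (hf : ContinuousOn f (Ici 0)) (h : ∀ t ∈ Ioi (0:ℝ), c ≤ f t) :
    ∀ t ∈ Ici (0:ℝ), c ≤ f t := by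
  intro t ht
  have hc : ContinuousWithinAt f (Ioi 0) t := (hf t ht).mono Ioi_subset_Ici_self
  have hcl : t ∈ closure (Ioi (0:ℝ)) := by rwa [closure_Ioi]
  have : (nhdsWithin t (Ioi 0)).NeBot := mem_closure_iff_nhdsWithin_neBot.mp hcl
  exact ge_of_tendsto hc (by filter_upwards [self_mem_nhdsWithin] with s hs using h s hs)
set_option maxHeartbeats 4000000 in
/-- Theorem 4.1, part 2 (exponential-asymptotic stability in the large): with
`ρ = ∞`, `0 ≤ τ < 1`, `sup_(t>0) g(t) < ∞` and `C' ≤ 0`, the null solution is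
exponential-asymptotically stable in the large. -/
theorem null_solution_exp_asymptotically_stable_in_the_large
    (ε ε' ε'' C C' F F' : ℝ → ℝ) (a' A τ k μ Cbar εbar ebar : ℝ)
    (hεderiv : ∀ t ∈ Ici (0:ℝ), HasDerivWithinAt ε (ε' t) (Ici 0) t)
    (hε'deriv : ∀ t ∈ Ici (0:ℝ), HasDerivWithinAt ε' (ε'' t) (Ici 0) t)
    (hε''cont : ContinuousOn ε'' (Ici 0))
    (hεnonneg : ∀ t ∈ Ici (0:ℝ), 0 ≤ ε t)
    (hCderiv : ∀ t ∈ Ici (0:ℝ), HasDerivWithinAt C (C' t) (Ici 0) t)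
    (hC'cont : ContinuousOn C' (Ici 0))
    (hFderiv : ∀ z, HasDerivAt F (F' z) z)
    (hF'cont : Continuous F')
    (hF0 : F 0 = 0)
    (hCbar : IsGLB (C '' Ioi (0:ℝ)) Cbar) (hCbarpos : 0 < Cbar)
    (hεbar : IsGLB (ε '' Ioi (0:ℝ)) εbar)
    (hebar : IsGLB (ε'' '' Ioi (0:ℝ)) ebar)
    (hA : 0 ≤ A) (hτ : 0 ≤ τ) (hk : 0 ≤ k) (hμ : 0 < μ)
    (hFk : ∀ z, F' z ≤ k)
    (hCk : k ≤ Cbar)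
    (hdiss : ∀ t ∈ Ici (0:ℝ), μ * (1 + ε t) ≤ C t - ε' t)
    (hmuk : 0 < μ + Cbar / 2 - 2 * k)
    (ha' : 0 ≤ a')
    (ha'ε : 0 < a' + εbar / 2)
    (hτ1 : τ < 1)
    (hg : ∃ gM, ∀ t ∈ Ioi (0:ℝ), C t - ε' t / 2 + 1 ≤ gM)
    (hC' : ∀ t ∈ Ici (0:ℝ), C' t ≤ 0)
    :
    ∀ δ, 0 < δ →
      ∃ D, 0 < D ∧ ∃ E, 0 < E ∧
        ∀ t₀, (0:ℝ) ≤ t₀ →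
          ∀ S : ClassicalSolution ε C F a' t₀,
            (∀ x ∈ Icc (0:ℝ) π, ∀ t ∈ Ici t₀, S.aa x t ≤ A * S.d t ^ τ) →
            S.d t₀ ≤ δ →
            ∀ t, t₀ ≤ t → S.d t ≤ D * Real.exp (-E * (t - t₀)) * S.d t₀ := by
  have cε : ContinuousOn ε (Ici 0) := fun s hs => (hεderiv s hs).continuousWithinAt
  have cε' : ContinuousOn ε' (Ici 0) := fun s hs => (hε'deriv s hs).continuousWithinAt
  have cC : ContinuousOn C (Ici 0) := fun s hs => (hCderiv s hs).continuousWithinAt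
  have cF : Continuous F := continuous_iff_continuousAt.2 fun z => (hFderiv z).continuousAt
  have bC : ∀ t ∈ Ici (0:ℝ), Cbar ≤ C t := ext_lb cC fun t ht => hCbar.1 ⟨t, ht, rfl⟩
  have bε : ∀ t ∈ Ici (0:ℝ), εbar ≤ ε t := ext_lb cε fun t ht => hεbar.1 ⟨t, ht, rfl⟩
  have be : ∀ t ∈ Ici (0:ℝ), ebar ≤ ε'' t := ext_lb hε''cont fun t ht => hebar.1 ⟨t, ht, rfl⟩
  have hεb0 : 0 ≤ εbar := by
    apply hεbar.2
    rintro _ ⟨t, ht, rfl⟩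
    exact hεnonneg t (Ioi_subset_Ici_self ht)
  have hCanti : AntitoneOn C (Ici 0) := by
    apply antitoneOn_of_deriv_nonpos (convex_Ici 0) cC
    · intro t ht
      rw [interior_Ici] at ht
      exact ((hCderiv t (Ioi_subset_Ici_self ht)).hasDerivAt (Ici_mem_nhds ht)).differentiableAt
        |>.differentiableWithinAt
    · intro t ht
      rw [interior_Ici] at ht
      rw [((hCderiv t (Ioi_subset_Ici_self ht)).hasDerivAt (Ici_mem_nhds ht)).deriv]
      exact hC' t (Ioi_subset_Ici_self ht)
  have bC0 : ∀ t ∈ Ici (0:ℝ), C t ≤ C 0 := fun t ht =>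
    hCanti (mem_Ici.2 le_rfl) ht ht
  have hC00 : 0 < C 0 := hCbarpos.trans_le (bC 0 (mem_Ici.2 le_rfl))
  obtain ⟨gM, hgM⟩ := hg
  obtain ⟨N, hN0, hN⟩ : ∃ N, 0 ≤ N ∧ ∀ t ∈ Ici (0:ℝ), - ε' t ≤ N := by
    refine ⟨max (2 * gM) 0, le_max_right _ _, ?_⟩
    have := ext_lb (f := ε') (c := - (max (2 * gM) 0)) cε' (fun t ht => by
      have h1 := hgM t ht
      have h2 := bC t (Ioi_subset_Ici_self ht)
      have h3 := le_max_left (2 * gM) 0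
      linarith)
    intro t ht
    linarith [this t ht]
  obtain ⟨hzF, hPhi⟩ := Phi_le hFderiv hF0 hFk
  -- choice of θ
  obtain ⟨θ, hθ0, hθ1, hθ2⟩ : ∃ θ, 0 ≤ θ ∧ k ≤ θ * (μ / 2) ∧
      |ebar| / 2 + a' * C 0 / 2 + 2 ≤ θ * (Cbar / 2 + μ / 2 - k) := by
    have hs : 0 < Cbar / 2 + μ / 2 - k := by linarith
    refine ⟨max (2 * k / μ) ((|ebar| / 2 + a' * C 0 / 2 + 2) / (Cbar / 2 + μ / 2 - k)), ?_, ?_, ?_⟩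
    · exact le_trans (by positivity) (le_max_left _ _)
    · have := le_max_left (2 * k / μ)
        ((|ebar| / 2 + a' * C 0 / 2 + 2) / (Cbar / 2 + μ / 2 - k))
      rw [div_le_iff₀ hμ] at this
      linarith
    · rw [← div_le_iff₀ hs]
      exact le_max_right _ _
  have hYc : ∀ γ, 0 ≤ γ → ∀ t ∈ Ici (0:ℝ),
      1 / 2 * (C' t * (1 + γ) - ε'' t + ε' t * (a' + θ)) - θ * C t + ε t * k + θ * k + 1
      ≤ - 1 := by
    intro γ hγ t ht
    have i1 : C' t * (1 + γ) ≤ 0 := mul_nonpos_of_nonpos_of_nonneg (hC' t ht) (by linarith)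
    have i2 := be t ht
    have i3 := neg_abs_le ebar
    have i4 := mul_le_mul_of_nonneg_right (hdiss t ht) (show 0 ≤ a' + θ by linarith)
    have i5 := mul_le_mul_of_nonneg_left hθ1 (hεnonneg t ht)
    have i6 := mul_le_mul_of_nonneg_left (bC t ht) hθ0
    have i7 := mul_le_mul_of_nonneg_left (bC0 t ht) ha'
    have i8 : 0 ≤ a' * μ * (1 + ε t) := by
      have := hεnonneg t ht
      positivity
    linarith
  intro δ hδ
  set c₁ := min (1 / 4) (Cbar / 16) with hc₁
  have hc₁pos : 0 < c₁ := lt_min (by norm_num) (by linarith)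
  set c₃ := min (1 / 2) (μ / 2) with hc₃
  have hc₃pos : 0 < c₃ := lt_min (by norm_num) (by linarith)
  obtain ⟨L, hL0, hL⟩ := Phi_ge hFderiv hF'cont hF0 (π + δ ^ 2)
  set K₀ := 1 + C 0 + N + a' + θ + a' * θ with hK₀
  have hK₀pos : 0 < K₀ := by positivity
  set p := a' + εbar with hp
  have hp0 : 0 < p := by linarith
  set γ₀ := 2 + 4 * θ ^ 2 / Cbar + (θ + 1) / p with hγ₀
  set γ₁ := 1 / (2 * μ) + θ ^ 2 / 4 with hγ₁
  have hγ₀pos : 2 ≤ γ₀ := by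
    have : 0 ≤ 4 * θ ^ 2 / Cbar + (θ + 1) / p := by positivity
    linarith
  have hγ₁pos : 0 ≤ γ₁ := by positivity
  -- choice of R
  obtain ⟨R, hR1, hR⟩ : ∃ R, 1 ≤ R ∧
      (1 + γ₀ + A * γ₁) * (K₀ + L) * (2 * δ ^ 2) / c₁ < R := by
    refine ⟨max 1 ((1 + γ₀ + A * γ₁) * (K₀ + L) * (2 * δ ^ 2) / c₁ + 1), le_max_left _ _, ?_⟩
    exact lt_of_lt_of_le (lt_add_one _) (le_max_right _ _)
  obtain ⟨L', hL'0, hL'⟩ := Phi_ge hFderiv hF'cont hF0 (π + R ^ 2)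
  set γ := γ₀ + A * R * γ₁ with hγ
  have hARγ : 0 ≤ A * R * γ₁ := by positivity
  have hγ0 : 0 ≤ γ := by linarith
  set κ := (1 + γ) * (K₀ + L) with hκ
  have hκpos : 0 < κ := by positivity
  set K' := (1 + γ) * (K₀ + L') with hK'
  have hK'pos : 0 < K' := by positivity
  have hκR : κ * (2 * δ ^ 2) < c₁ * R ^ 2 := by
    rw [div_lt_iff₀ hc₁pos] at hR
    have h1 : 1 + γ ≤ (1 + γ₀ + A * γ₁) * R := by
      have : 1 + γ₀ ≤ (1 + γ₀) * R := le_mul_of_one_le_right (by linarith) hR1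
      rw [hγ]; linarith
    have h2 : κ * (2 * δ ^ 2) ≤ (1 + γ₀ + A * γ₁) * R * (K₀ + L) * (2 * δ ^ 2) := by
      rw [hκ]; gcongr
    have h3 := mul_lt_mul_of_pos_right hR (show 0 < R by linarith)
    linarith
  set E := c₃ / K' / 2 with hE
  have hEpos : 0 < E := by positivity
  refine ⟨Real.sqrt (κ / c₁), Real.sqrt_pos.2 (by positivity), E / 2, by positivity, ?_⟩
  intro t₀ h0 S haa hd0 t ht
  have hdn : ∀ s, 0 ≤ S.d s := fun s => Real.sqrt_nonneg _
  have hbd := fun (s : ℝ) (hs : t₀ ≤ s) => W_bounds S (ε' := ε') (γ := γ) (θ := θ) (k := k)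
    (Cb := Cbar) (μ := μ) cF hs ha' hθ0 hk hCbarpos hCk hμ hmuk
    (by
      have : 0 ≤ (θ + 1) / p := by positivity
      rw [hγ, hγ₀]; linarith)
    (hεnonneg s (h0.trans hs)) (bC s (h0.trans hs)) (hdiss s (h0.trans hs)) hPhi
  have hder := fun (s : ℝ) (hs : t₀ ≤ s) => W_deriv S h0 γ θ hεderiv hε'deriv hε''cont hCderiv
    hC'cont cF hs
  set W := fun s => ∫ x in (0:ℝ)..π, wI S ε' γ θ x s with hW
  have hW0 : W t₀ ≤ κ * S.d t₀ ^ 2 :=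
    (hbd t₀ le_rfl).2 N (C 0) L δ hN0 hL0 (bC0 t₀ h0) (hN t₀ h0) hd0 hL
  have main : ∀ q, S.d t₀ ^ 2 < q → q ≤ 2 * δ ^ 2 →
      c₁ * S.d t ^ 2 ≤ κ * q * Real.exp (-E * (t - t₀)) := by
    intro q hq1 hq2
    have hq0 : 0 < q := lt_of_le_of_lt (sq_nonneg _) hq1
    refine (hbd t ht).1.trans ?_
    refine image_le_of_deriv_right_lt_deriv_boundary (f := W)
      (f' := fun s => ∫ x in (0:ℝ)..π, wT S ε' ε'' C' γ θ x s) (a := t₀) (b := t)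
      (B := fun s => κ * q * Real.exp (-E * (s - t₀)))
      (B' := fun s => - E * (κ * q * Real.exp (-E * (s - t₀)))) ?_ ?_ ?_ ?_ ?_ ⟨ht, le_rfl⟩
    · exact fun s hs => (hder s hs.1).continuousWithinAt.mono Icc_subset_Ici_self
    · exact fun s hs => (hder s hs.1).mono (Ici_subset_Ici.2 hs.1)
    · simp only [sub_self, mul_zero, Real.exp_zero, mul_one]
      refine hW0.trans ?_
      gcongr
    · intro s
      have h1 : HasDerivAt (fun s : ℝ => -E * (s - t₀)) (-E * 1) s :=
        ((hasDerivAt_id s).sub_const t₀).const_mul (-E)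
      exact (h1.exp.const_mul (κ * q)).congr_deriv (by ring)
    · intro s hs heq
      have hs0 : 0 ≤ s := h0.trans hs.1
      have hBpos : 0 < κ * q * Real.exp (-E * (s - t₀)) := by positivity
      have hBle : κ * q * Real.exp (-E * (s - t₀)) ≤ κ * q := by
        apply mul_le_of_le_one_right (by positivity)
        apply Real.exp_le_one_iff.2
        have := mul_nonneg hEpos.le (sub_nonneg.2 hs.1)
        linarith
      have hlow := (hbd s hs.1).1
      have hWs : W s ≤ κ * q := by rw [heq]; exact hBle
      have hdR : S.d s ≤ R := by
        have h1 : κ * q ≤ κ * (2 * δ ^ 2) := by gcongr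
        have h2 : c₁ * S.d s ^ 2 < c₁ * R ^ 2 := by
          refine lt_of_le_of_lt hlow ?_
          exact lt_of_le_of_lt (hWs.trans h1) hκR
        have h3 := lt_of_mul_lt_mul_left h2 hc₁pos.le
        exact (lt_of_pow_lt_pow_left₀ 2 (by linarith) h3).le
      have haM : ∀ x ∈ Icc (0:ℝ) π, S.aa x s ≤ A * R := by
        intro x hx
        refine (haa x hx s hs.1).trans ?_
        apply mul_le_mul_of_nonneg_left _ hA
        calc S.d s ^ τ ≤ R ^ τ := Real.rpow_le_rpow (hdn s) hdR hτ
          _ ≤ R ^ (1:ℝ) := Real.rpow_le_rpow_of_exponent_le hR1 hτ1.le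
          _ = R := Real.rpow_one R
      have hdl := W_deriv_le S h0 (ε' := ε') (ε'' := ε'') (C' := C') (γ := γ) (θ := θ) (k := k)
        (μ := μ) (M := A * R) cε cC hFderiv hF'cont hF0 hFk hs.1 ha' hθ0 hμ hk hγ0 haM
        (show A * R * γ₁ ≤ γ by rw [hγ]; linarith) (hεnonneg s hs0) (hdiss s hs0)
        (by
          have h1 : (θ + 1) / p ≤ γ := by
            have : 0 ≤ 4 * θ ^ 2 / Cbar := by positivity
            rw [hγ, hγ₀]; linarith
          rw [div_le_iff₀ hp0] at h1
          refine h1.trans ?_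
          apply mul_le_mul_of_nonneg_left _ hγ0
          have := bε s hs0
          linarith) (hYc γ hγ0 s hs0)
      have hup : W s ≤ K' * S.d s ^ 2 :=
        (hbd s hs.1).2 N (C 0) L' R hN0 hL'0 (bC0 s hs0) (hN s hs0) hdR hL'
      have h4 : 2 * E * W s ≤ c₃ * S.d s ^ 2 := by
        have h5 := mul_le_mul_of_nonneg_left hup (show 0 ≤ 2 * E by positivity)
        have h6 : 2 * E * (K' * S.d s ^ 2) = c₃ * S.d s ^ 2 := by
          rw [hE]; field_simp
        linarith
      rw [heq] at h4
      have h7 := mul_pos hEpos hBpos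
      refine lt_of_le_of_lt hdl ?_
      show - c₃ * S.d s ^ 2 < - E * (κ * q * Real.exp (-E * (s - t₀)))
      linarith
  have hlim : c₁ * S.d t ^ 2 ≤ κ * S.d t₀ ^ 2 * Real.exp (-E * (t - t₀)) := by
    have hlt : S.d t₀ ^ 2 < 2 * δ ^ 2 := by
      have : S.d t₀ ^ 2 ≤ δ ^ 2 := pow_le_pow_left₀ (hdn t₀) hd0 2
      have : 0 < δ ^ 2 := by positivity
      linarith
    have hT : Tendsto (fun q : ℝ => κ * q * Real.exp (-E * (t - t₀)))
        (nhdsWithin (S.d t₀ ^ 2) (Ioi (S.d t₀ ^ 2)))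
        (nhds (κ * S.d t₀ ^ 2 * Real.exp (-E * (t - t₀)))) := by
      apply Tendsto.mono_left _ nhdsWithin_le_nhds
      exact ((continuous_const.mul continuous_id).mul continuous_const).tendsto _
    exact ge_of_tendsto hT (by
      filter_upwards [Ioo_mem_nhdsGT hlt] with q hq using main q hq.1 hq.2.le)
  have hexp : Real.exp (-E * (t - t₀)) = Real.exp (-(E / 2) * (t - t₀)) ^ 2 := by
    rw [← Real.exp_nat_mul]
    congr 1
    push_cast
    ring
  refine (pow_le_pow_iff_left₀ (hdn t) (by have := hdn t₀; positivity) two_ne_zero).1 ?_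
  rw [mul_pow, mul_pow, Real.sq_sqrt (by positivity), ← hexp]
  rw [← mul_le_mul_iff_right₀ hc₁pos]
  refine hlim.trans (le_of_eq ?_)
  field_simp
end
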